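/- Let $T$ be a CEMPT on an infinite $\sigma$-finite measure space, $Y$ of finite positive measure, satisfying: (A2) $w_n^Y\sim n^{1-\alpha}\ell(n)$ for some $\alpha\in(0,1)$ and slowly varying $\ell$; (A3) $\{(w_n^Y)^{-1}\sum_{k=0}^{n-1}\hat T^k1_{Y_k}\}_{n\ge N}$ uniformly sweeping for $1_Y$; (A4) $(w_n^Y)^{-1}\sum_{k=0}^{n-1}\hat T^k1_{Y_k}\to H$ in $L^\infty(\mu)$. Then for every positive sequence $c(n)$ with $c(n)\to0$ and $nc(n)\to\infty$, $\mu_H(Z_n^Y/n\le c(n)) \sim \frac{\sin(\pi\alpha)}{\pi\alpha}\,\frac{c(n)^\alpha\,\ell(n)}{\ell(c(n)n)}$ as $n\to\infty$. -/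

import Mathlib

open MeasureTheory Filter Real Set
open scoped Topology ENNReal

/-- First return time to `Y` (value `⊤` if the orbit never returns). -/
noncomputable def firstReturn {X : Type*} (T : X → X) (Y : Set X) (x : X) : ℕ∞ :=
  ⨅ (k : ℕ) (_ : 1 ≤ k ∧ T^[k] x ∈ Y), (k : ℕ∞)

/-- The sets `Y₀ = Y`, `Yₙ = Yᶜ ∩ {φ = n}`. -/
noncomputable def Ypart {X : Type*} (T : X → X) (Y : Set X) : ℕ → Set X
  | 0 => Y
  | (n+1) => Yᶜ ∩ {x | firstReturn T Y x = ((n+1 : ℕ) : ℕ∞)}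

/-- The wandering rate `w_n^Y`. -/
noncomputable def wrate {X : Type*} [MeasurableSpace X] (T : X → X) (Y : Set X)
    (μ : Measure X) (n : ℕ) : ℝ≥0∞ :=
  ∑ k ∈ Finset.range n, μ (Y ∩ {x | (k : ℕ∞) < firstReturn T Y x})

/-- The normalized entrance densities `(w_n^Y)⁻¹ ∑_{k<n} T̂^k 1_{Y_k}`. -/
noncomputable def entrance {X : Type*} [MeasurableSpace X] (T : X → X) (Y : Set X)
    (μ : Measure X) (hatT : (X → ℝ≥0∞) → (X → ℝ≥0∞)) (n : ℕ) (x : X) : ℝ≥0∞ :=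
  (∑ k ∈ Finset.range n, (hatT^[k] ((Ypart T Y k).indicator fun _ => (1:ℝ≥0∞))) x) /
    wrate T Y μ n

/-- Last visit time to `Y` up to time `n` (with `max ∅ = 0`). -/
noncomputable def lastVisit {X : Type*} (T : X → X) (Y : Set X) (n : ℕ) (x : X) : ℕ :=
  sSup {k | k ≤ n ∧ T^[k] x ∈ Y}



/-- averaging functional for the uniform convergence theorem -/
lemma uct_avg {h : ℝ → ℝ} (hm : Measurable h)
    (hh : ∀ u, Tendsto (fun y => h (y + u) - h y) atTop (𝓝 0)) :
    Tendsto (fun y => ∫ u in Icc (0:ℝ) 2, min 1 |h (y + u) - h y|) atTop (𝓝 0) := by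
  have key := tendsto_integral_filter_of_dominated_convergence (μ := volume.restrict (Icc (0:ℝ) 2))
    (l := (atTop : Filter ℝ)) (F := fun y u => min 1 |h (y + u) - h y|) (f := fun _ => (0:ℝ))
    (fun _ => (1:ℝ)) ?_ ?_ ?_ ?_
  · simpa using key
  · refine Eventually.of_forall fun y => Measurable.aestronglyMeasurable ?_
    fun_prop
  · refine Eventually.of_forall fun y => Eventually.of_forall fun u => ?_
    rw [Real.norm_of_nonneg (by positivity)]
    exact min_le_left _ _
  · exact integrable_const _
  · refine Eventually.of_forall fun u => ?_
    have h1 := (hh u).abs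
    have h2 := (tendsto_const_nhds (x := (1:ℝ))).min h1
    simpa using h2

lemma min_one_abs_sub (a b c : ℝ) : min 1 |a - b| ≤ min 1 |c - b| + min 1 |c - a| := by
  have h1 := abs_sub_le a c b
  rw [abs_sub_comm a c] at h1
  rcases min_cases 1 |a - b| with h | h <;> rcases min_cases 1 |c - b| with h' | h' <;>
    rcases min_cases 1 |c - a| with h'' | h'' <;> 
    linarith [abs_nonneg (a-b), abs_nonneg (c-b), abs_nonneg (c-a)]

lemma uct_bound {h : ℝ → ℝ} (hm : Measurable h) (y u : ℝ) (hu : u ∈ Icc (0:ℝ) 1) :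
    min 1 |h (y + u) - h y| ≤ (∫ v in Icc (0:ℝ) 2, min 1 |h (y + v) - h y|)
      + ∫ v in Icc (0:ℝ) 2, min 1 |h ((y + u) + v) - h (y + u)| := by
  have hintg : ∀ (z w : ℝ) (s : Set ℝ), volume s ≠ ⊤ → IntegrableOn (fun v => min 1 |h (z + v) - h w|) s := by
    intro z w s hs
    have : IsFiniteMeasure (volume.restrict s) := ⟨by simpa using hs.lt_top⟩
    refine Integrable.mono' (integrable_const (1:ℝ)) (Measurable.aestronglyMeasurable (by fun_prop)) ?_
    refine Eventually.of_forall fun u => ?_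
    rw [Real.norm_of_nonneg (by positivity)]
    exact min_le_left _ _
  have hI : ∀ a b : ℝ, volume (Icc a b) ≠ ⊤ := fun a b => by simp
  have e1 : min 1 |h (y + u) - h y| = ∫ v in Icc (1:ℝ) 2, min 1 |h (y + u) - h y| := by
    simp; norm_num
  have e2 : (∫ v in Icc (1:ℝ) 2, min 1 |h (y + u) - h y|) ≤
      ∫ v in Icc (1:ℝ) 2, (min 1 |h (y + v) - h y| + min 1 |h (y + v) - h (y + u)|) := by
    refine setIntegral_mono_on ?_ ((hintg _ _ _ (hI _ _)).add (hintg _ _ _ (hI _ _))) measurableSet_Icc ?_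
    · simp
    · intro v hv
      exact min_one_abs_sub _ _ _
  rw [integral_add (hintg _ _ _ (hI _ _)) (hintg _ _ _ (hI _ _))] at e2
  have e3 : (∫ v in Icc (1:ℝ) 2, min 1 |h (y + v) - h y|) ≤ ∫ v in Icc (0:ℝ) 2, min 1 |h (y + v) - h y| := by
    refine setIntegral_mono_set (hintg _ _ _ (hI _ _)) (Eventually.of_forall fun v => by positivity) ?_
    exact (Icc_subset_Icc (by norm_num) le_rfl).eventuallyLE
  have e4 : (∫ v in Icc (1:ℝ) 2, min 1 |h (y + v) - h (y + u)|) =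
      ∫ v in Icc (1 - u:ℝ) (2 - u), min 1 |h ((y + u) + v) - h (y + u)| := by
    rw [integral_Icc_eq_integral_Ioc, integral_Icc_eq_integral_Ioc,
      ← intervalIntegral.integral_of_le (by norm_num), ← intervalIntegral.integral_of_le (by linarith)]
    have := intervalIntegral.integral_comp_sub_right (a := 1) (b := 2)
      (fun v => min 1 |h ((y + u) + v) - h (y + u)|) u
    rw [← this]
    congr 1; ext v; congr 4; ring
  have e5 : (∫ v in Icc (1 - u:ℝ) (2 - u), min 1 |h ((y + u) + v) - h (y + u)|) ≤
      ∫ v in Icc (0:ℝ) 2, min 1 |h ((y + u) + v) - h (y + u)| := by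
    refine setIntegral_mono_set (hintg _ _ _ (hI _ _)) (Eventually.of_forall fun v => by positivity) ?_
    exact (Icc_subset_Icc (by linarith [hu.2]) (by linarith [hu.1])).eventuallyLE
  linarith

lemma sv_floor {ℓ : ℝ → ℝ} (hm : Measurable ℓ) (hpos : ∀ t, 0 < t → 0 < ℓ t)
    (hsv : ∀ lam : ℝ, 0 < lam → Tendsto (fun t => ℓ (lam * t) / ℓ t) atTop (𝓝 1)) :
    Tendsto (fun x : ℝ => ℓ (⌊x⌋₊ : ℝ) / ℓ x) atTop (𝓝 1) := by
  set h : ℝ → ℝ := fun y => Real.log (ℓ (Real.exp y)) with hdef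
  have hme : Measurable h := by fun_prop
  have hh : ∀ u, Tendsto (fun y => h (y + u) - h y) atTop (𝓝 0) := by
    intro u
    have h1 := (hsv (Real.exp u) (Real.exp_pos u)).comp Real.tendsto_exp_atTop
    have h2 := h1.log one_ne_zero
    rw [Real.log_one] at h2
    refine h2.congr fun y => ?_
    simp only [Function.comp, hdef]
    rw [Real.log_div (hpos _ (by positivity)).ne' (hpos _ (by positivity)).ne', Real.exp_add, mul_comm]
  have hF := uct_avg hme hh
  have hfl : Tendsto (fun x : ℝ => Real.log (⌊x⌋₊ : ℝ)) atTop atTop :=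
    Real.tendsto_log_atTop.comp (tendsto_natCast_atTop_atTop.comp tendsto_nat_floor_atTop)
  have h3 := (hF.comp hfl).add (hF.comp Real.tendsto_log_atTop)
  have h4 : Tendsto (fun x : ℝ => min 1 |h (Real.log x) - h (Real.log (⌊x⌋₊ : ℝ))|) atTop (𝓝 0) := by
    rw [add_zero] at h3
    refine tendsto_of_tendsto_of_tendsto_of_le_of_le' tendsto_const_nhds h3
      (Eventually.of_forall fun x => by positivity) ?_
    filter_upwards [eventually_ge_atTop 1] with x hx
    have hfp : (1:ℝ) ≤ ⌊x⌋₊ := by exact_mod_cast (Nat.le_floor (by simpa using hx))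
    have hfx : (⌊x⌋₊ : ℝ) ≤ x := Nat.floor_le (by linarith)
    have hfx2 : x < ⌊x⌋₊ + 1 := Nat.lt_floor_add_one x
    have hu : Real.log x - Real.log (⌊x⌋₊ : ℝ) ∈ Icc (0:ℝ) 1 := by
      constructor
      · linarith [Real.log_le_log (by linarith) hfx]
      · rw [← Real.log_div (by linarith) (by linarith)]
        have : x / ⌊x⌋₊ ≤ 2 := by rw [div_le_iff₀ (by linarith)]; linarith
        have := Real.log_le_sub_one_of_pos (x := x / ⌊x⌋₊) (by positivity)
        linarith
    have := uct_bound hme (Real.log (⌊x⌋₊ : ℝ)) _ hu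
    simpa only [add_sub_cancel, Function.comp] using this
  have h5 : Tendsto (fun x : ℝ => |h (Real.log x) - h (Real.log (⌊x⌋₊ : ℝ))|) atTop (𝓝 0) := by
    refine h4.congr' ?_
    filter_upwards [h4.eventually (gt_mem_nhds (show (0:ℝ) < 1 by norm_num))] with x hx
    rcases min_lt_iff.1 hx with h | h
    · exact absurd h (lt_irrefl _)
    · exact min_eq_right h.le
  have h6 := (tendsto_zero_iff_abs_tendsto_zero _).2 h5
  have h7 := (h6.neg).rexp
  rw [neg_zero, Real.exp_zero] at h7
  refine h7.congr' ?_
  filter_upwards [eventually_ge_atTop 1] with x hx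
  have hfp : (1:ℝ) ≤ ⌊x⌋₊ := by exact_mod_cast (Nat.le_floor (by simpa using hx))
  simp only [hdef]
  rw [Real.exp_log (by linarith), Real.exp_log (by linarith), neg_sub, Real.exp_sub,
    Real.exp_log (hpos _ (by linarith)), Real.exp_log (hpos _ (by linarith))]

lemma floor_div_tendsto : Tendsto (fun x : ℝ => (⌊x⌋₊ : ℝ) / x) atTop (𝓝 1) :=
  tendsto_nat_floor_div_atTop

lemma w_floor {ℓ : ℝ → ℝ} (hm : Measurable ℓ) (hpos : ∀ t, 0 < t → 0 < ℓ t)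
    (hsv : ∀ lam : ℝ, 0 < lam → Tendsto (fun t => ℓ (lam * t) / ℓ t) atTop (𝓝 1))
    {w : ℕ → ℝ} {β : ℝ}
    (hw : Tendsto (fun n : ℕ => w n / ((n : ℝ) ^ β * ℓ n)) atTop (𝓝 1)) :
    Tendsto (fun x : ℝ => w ⌊x⌋₊ / (x ^ β * ℓ x)) atTop (𝓝 1) := by
  have h1 := hw.comp (tendsto_nat_floor_atTop (α := ℝ))
  have h2 := sv_floor hm hpos hsv
  have h3 := (floor_div_tendsto).rpow_const (p := β) (Or.inl one_ne_zero)
  have h4 := (h1.mul h2).mul h3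
  rw [Real.one_rpow, one_mul, one_mul] at h4
  refine h4.congr' ?_
  filter_upwards [eventually_ge_atTop 1] with x hx
  have hfp : (1:ℝ) ≤ ⌊x⌋₊ := by exact_mod_cast (Nat.le_floor (by simpa using hx))
  simp only [Function.comp]
  rw [Real.div_rpow (by linarith) (by linarith)]
  have := hpos x (by linarith)
  have := hpos ⌊x⌋₊ (by linarith)
  have : 0 < x ^ β := Real.rpow_pos_of_pos (by linarith) _
  have : 0 < (⌊x⌋₊:ℝ) ^ β := Real.rpow_pos_of_pos (by linarith) _
  field_simp

lemma w_ratio {ℓ : ℝ → ℝ} (hm : Measurable ℓ) (hpos : ∀ t, 0 < t → 0 < ℓ t)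
    (hsv : ∀ lam : ℝ, 0 < lam → Tendsto (fun t => ℓ (lam * t) / ℓ t) atTop (𝓝 1))
    {w : ℕ → ℝ} {β : ℝ}
    (hw : Tendsto (fun n : ℕ => w n / ((n : ℝ) ^ β * ℓ n)) atTop (𝓝 1)) (t : ℝ) (ht : 0 < t) :
    Tendsto (fun n : ℕ => w ⌊t * n⌋₊ / w n) atTop (𝓝 (t ^ β)) := by
  have h1 := (w_floor hm hpos hsv hw).comp
    ((tendsto_natCast_atTop_atTop (R := ℝ)).const_mul_atTop ht)
  have h2 := (hsv t ht).comp (tendsto_natCast_atTop_atTop (R := ℝ))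
  have h3 := ((h1.mul h2).mul_const (t ^ β)).div hw one_ne_zero
  simp only [one_mul, div_one] at h3
  refine h3.congr' ?_
  filter_upwards [eventually_ge_atTop 1] with n hn
  have hn' : (0:ℝ) < n := by exact_mod_cast hn
  simp only [Function.comp, Pi.div_apply]
  rw [Real.mul_rpow ht.le hn'.le]
  have := hpos n hn'
  have := hpos (t * n) (by positivity)
  have : 0 < t ^ β := Real.rpow_pos_of_pos ht _
  have : 0 < (n:ℝ) ^ β := Real.rpow_pos_of_pos hn' _
  field_simp

section wlemmas
variable {b : ℕ → ℝ} {w : ℕ → ℝ}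

lemma w_sub_le (hb : Antitone b) (hw : ∀ n, w n = ∑ k ∈ Finset.range n, b k) {k n : ℕ} (h : k ≤ n) :
    w n - w k ≤ ((n:ℝ) - k) * b k := by
  rw [hw, hw, ← Finset.sum_Ico_eq_sub _ h]
  have := Finset.sum_le_card_nsmul (Finset.Ico k n) b (b k) (fun i hi => hb (Finset.mem_Ico.1 hi).1)
  simpa [Nat.cast_sub h] using this

lemma le_w_sub (hb : Antitone b) (hw : ∀ n, w n = ∑ k ∈ Finset.range n, b k) {k n : ℕ} (h : k ≤ n) :
    ((n:ℝ) - k) * b n ≤ w n - w k := by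
  rw [hw, hw, ← Finset.sum_Ico_eq_sub _ h]
  have := Finset.card_nsmul_le_sum (Finset.Ico k n) b (b n) (fun i hi => hb (Finset.mem_Ico.1 hi).2.le)
  simpa [Nat.cast_sub h] using this

lemma w_zero (hw : ∀ n, w n = ∑ k ∈ Finset.range n, b k) : w 0 = 0 := by simp [hw]

lemma w_mono (h0 : ∀ n, 0 ≤ b n) (hw : ∀ n, w n = ∑ k ∈ Finset.range n, b k) : Monotone w := by
  refine monotone_nat_of_le_succ fun n => ?_
  rw [hw, hw, Finset.sum_range_succ]
  linarith [h0 n]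

lemma w_conc (hb : Antitone b) (hw : ∀ n, w n = ∑ k ∈ Finset.range n, b k) {k n : ℕ} (h : k ≤ n) :
    (k:ℝ) * w n ≤ n * w k := by
  have h1 := w_sub_le hb hw h
  have h2 := le_w_sub hb hw (Nat.zero_le k)
  rw [w_zero hw] at h2
  have h3 : (k:ℝ) ≤ n := by exact_mod_cast h
  have h4 : (0:ℝ) ≤ k := by positivity
  simp only [Nat.cast_zero, sub_zero] at h2
  nlinarith

lemma w_pos (h0 : ∀ n, 0 ≤ b n) (hb0 : 0 < b 0) (hw : ∀ n, w n = ∑ k ∈ Finset.range n, b k)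
    {n : ℕ} (hn : 1 ≤ n) : 0 < w n := by
  have : w 1 ≤ w n := w_mono h0 hw hn
  have h1 : w 1 = b 0 := by simp [hw]
  linarith

lemma w_potter (h0 : ∀ n, 0 ≤ b n) (hb : Antitone b) (hb0 : 0 < b 0)
    (hw : ∀ n, w n = ∑ k ∈ Finset.range n, b k) (n : ℕ) {m : ℕ} (hm : 1 ≤ m) :
    w n / w m ≤ n / m + 1 := by
  have hp := w_pos h0 hb0 hw hm
  have hm' : (0:ℝ) < m := by exact_mod_cast hm
  rcases le_total n m with h | h
  · have : w n / w m ≤ 1 := by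
      rw [div_le_one hp]; exact w_mono h0 hw h
    have : (0:ℝ) ≤ n / m := by positivity
    linarith
  · have := w_conc hb hw h
    have : w n / w m ≤ n / m := by
      rw [div_le_div_iff₀ hp hm']; linarith
    linarith

lemma tendsto_floor_mul_div (t : ℝ) (ht : 0 < t) :
    Tendsto (fun n : ℕ => (⌊t * n⌋₊ : ℝ) / n) atTop (𝓝 t) :=
  (tendsto_nat_floor_mul_div_atTop ht.le).comp tendsto_natCast_atTop_atTop

lemma mono_density (h0 : ∀ n, 0 ≤ b n) (hb : Antitone b) (hb0 : 0 < b 0)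
    (hw : ∀ n, w n = ∑ k ∈ Finset.range n, b k) {β : ℝ}
    (hr : ∀ t : ℝ, 0 < t → Tendsto (fun n : ℕ => w ⌊t * n⌋₊ / w n) atTop (𝓝 (t ^ β))) :
    Tendsto (fun n : ℕ => n * b n / w n) atTop (𝓝 β) := by
  have hd : HasDerivAt (fun t : ℝ => t ^ β) β 1 := by
    simpa using Real.hasDerivAt_rpow_const (x := 1) (p := β) (Or.inl one_ne_zero)
  have hs := hasDerivAt_iff_tendsto_slope.1 hd
  have hlim : ∀ t : ℝ, 0 < t → t ≠ 1 → Tendsto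
      (fun n : ℕ => (w ⌊t * n⌋₊ / w n - 1) / ((⌊t * n⌋₊ : ℝ) / n - 1)) atTop
      (𝓝 (slope (fun t : ℝ => t ^ β) 1 t)) := by
    intro t ht ht1
    rw [slope_def_field, Real.one_rpow]
    exact ((hr t ht).sub_const 1).div ((tendsto_floor_mul_div t ht).sub_const 1) (sub_ne_zero.2 ht1)
  rw [tendsto_order]
  constructor
  · intro a ha
    have h1 : ∀ᶠ t in 𝓝[>] (1:ℝ), a < slope (fun t : ℝ => t ^ β) 1 t :=
      (hs.mono_left (nhdsWithin_mono _ (fun x hx => ne_of_gt hx))).eventually (lt_mem_nhds ha)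
    obtain ⟨t, hta, ht1⟩ := (h1.and self_mem_nhdsWithin).exists
    have ht1 : 1 < t := ht1
    filter_upwards [(hlim t (by linarith) ht1.ne').eventually (lt_mem_nhds hta),
      (tendsto_floor_mul_div t (by linarith)).eventually (lt_mem_nhds ht1), eventually_ge_atTop 1]
      with n h2 h3 hn
    refine h2.trans_le ?_
    have hn' : (0:ℝ) < n := by exact_mod_cast hn
    have hp := w_pos h0 hb0 hw hn
    have h4 : (n:ℝ) < ⌊t * n⌋₊ := by rwa [lt_div_iff₀ hn', one_mul] at h3
    have h5 := w_sub_le hb hw (k := n) (n := ⌊t * n⌋₊) (by exact_mod_cast h4.le)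
    rw [div_le_iff₀ (by linarith)]
    have : n * b n / w n * ((⌊t * n⌋₊ : ℝ) / n - 1) = (((⌊t * n⌋₊:ℝ) - n) * b n) / w n := by
      field_simp
    rw [this, div_sub_one hp.ne']
    gcongr
  · intro a ha
    have h1 : ∀ᶠ t in 𝓝[<] (1:ℝ), slope (fun t : ℝ => t ^ β) 1 t < a :=
      (hs.mono_left (nhdsWithin_mono _ (fun x hx => ne_of_lt hx))).eventually (gt_mem_nhds ha)
    have hh : ∀ᶠ t in 𝓝[<] (1:ℝ), 0 < t :=
      nhdsWithin_le_nhds (lt_mem_nhds one_pos)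
    obtain ⟨t, ⟨hta, ht1⟩, ht0⟩ := ((h1.and self_mem_nhdsWithin).and hh).exists
    have ht1 : t < 1 := ht1
    filter_upwards [(hlim t (by linarith) ht1.ne).eventually (gt_mem_nhds hta),
      (tendsto_floor_mul_div t (by linarith)).eventually (gt_mem_nhds ht1), eventually_ge_atTop 1]
      with n h2 h3 hn
    refine lt_of_le_of_lt ?_ h2
    have hn' : (0:ℝ) < n := by exact_mod_cast hn
    have hp := w_pos h0 hb0 hw hn
    have h4 : (⌊t * n⌋₊:ℝ) < n := by rwa [div_lt_iff₀ hn', one_mul] at h3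
    have h5 := le_w_sub hb hw (k := ⌊t * n⌋₊) (n := n) (by exact_mod_cast h4.le)
    rw [le_div_iff_of_neg (by linarith)]
    have : n * b n / w n * ((⌊t * n⌋₊ : ℝ) / n - 1) = -((((n:ℝ) - ⌊t * n⌋₊) * b n) / w n) := by
      field_simp; ring
    rw [this, div_sub_one hp.ne', le_neg, ← neg_div, neg_sub]
    gcongr

lemma integral_floor {F : ℕ → ℝ} (hF : IntegrableOn (fun t : ℝ => F ⌊t⌋₊) (Ioi 0)) :
    HasSum F (∫ t in Ioi (0:ℝ), F ⌊t⌋₊) := by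
  have hU : (⋃ n : ℕ, Ico (n:ℝ) (n+1)) = Ici 0 := by
    ext t
    simp only [mem_iUnion, mem_Ico, mem_Ici]
    constructor
    · rintro ⟨n, h1, h2⟩
      exact le_trans (by positivity) h1
    · intro h
      exact ⟨⌊t⌋₊, Nat.floor_le h, Nat.lt_floor_add_one t⟩
  have hd : Pairwise (Function.onFun Disjoint fun n : ℕ => Ico (n:ℝ) (n+1)) := by
    intro i j hij
    rw [Function.onFun, Set.disjoint_left]
    intro t hi hj
    apply hij
    have h0 : 0 ≤ t := le_trans (by positivity) hi.1
    rw [← (Nat.floor_eq_iff h0).2 hi, ← (Nat.floor_eq_iff h0).2 hj]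
  have h1 := hasSum_integral_iUnion (μ := volume) (f := fun t : ℝ => F ⌊t⌋₊) (s := fun n : ℕ => Ico (n:ℝ) (n+1))
    (fun _ => measurableSet_Ico) hd (by rw [hU, integrableOn_Ici_iff_integrableOn_Ioi]; exact hF)
  rw [hU, integral_Ici_eq_integral_Ioi] at h1
  have hF' : (fun n : ℕ => ∫ x in Ico (n:ℝ) (n+1), F ⌊x⌋₊) = F := by
    ext n
    rw [setIntegral_congr_fun (g := fun _ => F n) measurableSet_Ico]
    · simp
    · intro t ht
      simp only
      rw [(Nat.floor_eq_iff (le_trans (by positivity) ht.1)).2 ht]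
  rwa [hF'] at h1

lemma laplace_w (h0 : ∀ n, 0 ≤ b n) (hb : Antitone b) (hb0 : 0 < b 0)
    (hw : ∀ n, w n = ∑ k ∈ Finset.range n, b k) {β : ℝ} (hβ : 0 < β)
    (hr : ∀ t : ℝ, 0 < t → Tendsto (fun n : ℕ => w ⌊t * n⌋₊ / w n) atTop (𝓝 (t ^ β)))
    (lam : ℝ) (hl : 0 < lam) :
    Tendsto (fun m : ℕ => (∑' N : ℕ, Real.exp (-(lam / m)) ^ N * w N) / (m * w m)) atTop
      (𝓝 ((1 / lam) ^ (β + 1) * Real.Gamma (β + 1))) := by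
  set G : ℕ → ℝ → ℝ := fun m t => Real.exp (-(lam / m)) ^ ⌊m * t⌋₊ * (w ⌊m * t⌋₊ / w m) with hG
  set bd : ℝ → ℝ := fun t => Real.exp lam * (1 + 2 / lam) * Real.exp (-(lam / 2) * t) with hbd
  have hbdint : IntegrableOn bd (Ioi 0) :=
    (exp_neg_integrableOn_Ioi 0 (by positivity : 0 < lam / 2)).const_mul _
  have hGm : ∀ m, Measurable (G m) := by
    intro m
    have : G m = (fun k : ℕ => Real.exp (-(lam / m)) ^ k * (w k / w m)) ∘ fun t : ℝ => ⌊m * t⌋₊ := rfl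
    rw [this]
    exact (measurable_from_nat).comp (Nat.measurable_floor.comp (by fun_prop))
  have hGle : ∀ m : ℕ, 1 ≤ m → ∀ t ∈ Ioi (0:ℝ), ‖G m t‖ ≤ bd t := by
    intro m hm t ht
    have ht : 0 < t := ht
    have hp := w_pos h0 hb0 hw hm
    have hm' : (0:ℝ) < m := by exact_mod_cast hm
    have hm1 : (1:ℝ) ≤ m := by exact_mod_cast hm
    have hwn : 0 ≤ w ⌊m * t⌋₊ := by rw [hw]; exact Finset.sum_nonneg fun i _ => h0 i
    rw [Real.norm_of_nonneg (by positivity)]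
    have e1 : Real.exp (-(lam / m)) ^ ⌊m * t⌋₊ ≤ Real.exp lam * Real.exp (-lam * t) := by
      rw [← Real.exp_nat_mul, ← Real.exp_add, Real.exp_le_exp]
      have h1 : m * t < ⌊m * t⌋₊ + 1 := Nat.lt_floor_add_one _
      have h2 : (⌊m * t⌋₊ : ℝ) * -(lam / m) ≤ (m * t - 1) * -(lam / m) := by
        apply mul_le_mul_of_nonpos_right (by linarith)
        have : 0 < lam / m := by positivity
        linarith
      have h3 : (m * t - 1) * -(lam / m) = lam / m - lam * t := by field_simp; ring
      have h4 : lam / m ≤ lam := div_le_self hl.le hm1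
      linarith
    have e2 : w ⌊m * t⌋₊ / w m ≤ (1 + 2 / lam) * Real.exp (lam / 2 * t) := by
      refine (w_potter h0 hb hb0 hw _ hm).trans ?_
      have h1 : (⌊m * t⌋₊ : ℝ) / m ≤ t := by
        rw [div_le_iff₀ hm', mul_comm t]; exact Nat.floor_le (by positivity)
      have h2 := Real.add_one_le_exp (lam / 2 * t)
      have h3 : 0 < lam / 2 * t := by positivity
      have h4 : t = 2 / lam * (lam / 2 * t) := by field_simp
      have h5 : 2 / lam * (lam / 2 * t) ≤ 2 / lam * Real.exp (lam / 2 * t) := by gcongr; linarith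
      nlinarith
    calc _ ≤ (Real.exp lam * Real.exp (-lam * t)) * ((1 + 2 / lam) * Real.exp (lam / 2 * t)) :=
          mul_le_mul e1 e2 (by positivity) (by positivity)
      _ = Real.exp lam * (1 + 2 / lam) * (Real.exp (-lam * t) * Real.exp (lam / 2 * t)) := by ring
      _ = bd t := by rw [← Real.exp_add, hbd]; congr 2; ring
  have hGint : ∀ m : ℕ, 1 ≤ m → IntegrableOn (G m) (Ioi 0) := fun m hm =>
    hbdint.mono' (hGm m).aestronglyMeasurable
      ((ae_restrict_iff' measurableSet_Ioi).2 (Eventually.of_forall (hGle m hm)))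
  have hGlim : ∀ t ∈ Ioi (0:ℝ), Tendsto (fun m => G m t) atTop (𝓝 (Real.exp (-(lam * t)) * t ^ β)) := by
    intro t ht
    have ht : 0 < t := ht
    refine Tendsto.mul ?_ ?_
    · have h1 := ((tendsto_floor_mul_div t ht).const_mul (-lam)).rexp
      rw [neg_mul] at h1
      refine h1.congr fun m => ?_
      rw [← Real.exp_nat_mul, mul_comm t]
      congr 1; ring
    · have := hr t ht
      simpa only [mul_comm t] using this
  have key := tendsto_integral_of_dominated_convergence (μ := volume.restrict (Ioi (0:ℝ)))
    (F := fun m => G (m + 1)) (f := fun t => Real.exp (-(lam * t)) * t ^ β) bd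
    (fun m => (hGm _).aestronglyMeasurable) hbdint
    (fun m => (ae_restrict_iff' measurableSet_Ioi).2 (Eventually.of_forall (hGle (m+1) (by omega))))
    ((ae_restrict_iff' measurableSet_Ioi).2 (Eventually.of_forall fun t ht =>
      (hGlim t ht).comp (tendsto_add_atTop_nat 1)))
  have hI : ∫ t in Ioi (0:ℝ), Real.exp (-(lam * t)) * t ^ β = (1 / lam) ^ (β + 1) * Real.Gamma (β + 1) := by
    rw [← Real.integral_rpow_mul_exp_neg_mul_Ioi (by positivity : 0 < β + 1) hl]
    refine setIntegral_congr_fun measurableSet_Ioi fun t ht => ?_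
    simp [mul_comm]
  rw [hI] at key
  rw [← tendsto_add_atTop_iff_nat 1]
  refine key.congr fun m' => ?_
  set m := m' + 1 with hmdef
  have hm' : (0:ℝ) < m := by rw [hmdef]; positivity
  have h1 := integral_comp_mul_left_Ioi (fun t : ℝ => Real.exp (-(lam / m)) ^ ⌊t⌋₊ * (w ⌊t⌋₊ / w m)) 0 hm'
  have h2 := hGint m (by omega)
  have h3 := (integrableOn_Ioi_comp_mul_left_iff
    (fun t : ℝ => Real.exp (-(lam / m)) ^ ⌊t⌋₊ * (w ⌊t⌋₊ / w m)) 0 hm').1 h2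
  rw [mul_zero] at h1 h3
  have h4 := (integral_floor (F := fun k => Real.exp (-(lam / m)) ^ k * (w k / w m)) h3).tsum_eq
  change ∫ t in Ioi (0:ℝ), Real.exp (-(lam / m)) ^ ⌊m * t⌋₊ * (w ⌊m * t⌋₊ / w m) = _
  rw [h1, ← h4, smul_eq_mul]
  simp_rw [← mul_div_assoc]
  rw [tsum_div_const]
  field_simp

end wlemmas

lemma pos_fun_conv {ι : Type*} {l : Filter ι} (L : ι → C(ℝ, ℝ) →ₗ[ℝ] ℝ) (L0 : C(ℝ, ℝ) →ₗ[ℝ] ℝ)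
    (hL : ∀ i (f g : C(ℝ, ℝ)), (∀ x ∈ Icc (0:ℝ) 1, f x ≤ g x) → L i f ≤ L i g)
    (hL0 : ∀ (f g : C(ℝ, ℝ)), (∀ x ∈ Icc (0:ℝ) 1, f x ≤ g x) → L0 f ≤ L0 g)
    (hmom : ∀ k : ℕ, Tendsto (fun i => L i (ContinuousMap.id ℝ ^ k)) l (𝓝 (L0 (ContinuousMap.id ℝ ^ k))))
    (g : C(ℝ, ℝ)) : Tendsto (fun i => L i g) l (𝓝 (L0 g)) := by
  have hpoly : ∀ p : Polynomial ℝ, Tendsto (fun i => L i p.toContinuousMap) l (𝓝 (L0 p.toContinuousMap)) := by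
    intro p
    induction p using Polynomial.induction_on' with
    | add p q hp hq =>
      have : (p + q).toContinuousMap = p.toContinuousMap + q.toContinuousMap := by ext; simp
      simp only [this, map_add]
      exact hp.add hq
    | monomial n a =>
      have : (Polynomial.monomial n a).toContinuousMap = a • (ContinuousMap.id ℝ ^ n) := by ext; simp
      simp only [this, map_smul]
      exact (hmom n).const_smul a
  have bound : ∀ (M : C(ℝ, ℝ) →ₗ[ℝ] ℝ), (∀ (f g : C(ℝ, ℝ)), (∀ x ∈ Icc (0:ℝ) 1, f x ≤ g x) → M f ≤ M g) →
      ∀ (p : C(ℝ, ℝ)) (ε : ℝ), (∀ x ∈ Icc (0:ℝ) 1, |p x - g x| < ε) → |M p - M g| ≤ ε * M 1 := by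
    intro M hM p ε hp
    have e : ε * M 1 = M (ε • 1) := by simp
    rw [abs_le]
    constructor
    · have := hM g (p + ε • 1) (fun x hx => by
        have := (abs_lt.1 (hp x hx)).1
        simp; linarith)
      rw [map_add, ← e] at this; linarith
    · have := hM p (g + ε • 1) (fun x hx => by
        have := (abs_lt.1 (hp x hx)).2
        simp; linarith)
      rw [map_add, ← e] at this; linarith
  have h1 : Tendsto (fun i => L i 1) l (𝓝 (L0 1)) := by simpa using hmom 0
  have hnn : 0 ≤ L0 1 := by
    have := hL0 0 1 (fun x hx => by simp)
    simpa using this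
  rw [Metric.tendsto_nhds]
  intro ε hε
  set δ := ε / (4 * (L0 1 + 1)) with hδ
  have hδp : 0 < δ := by positivity
  obtain ⟨p, hp⟩ := exists_polynomial_near_of_continuousOn 0 1 g g.continuous.continuousOn δ hδp
  filter_upwards [h1.eventually (gt_mem_nhds (show L0 1 < L0 1 + 1 by linarith)),
    (Metric.tendsto_nhds.1 (hpoly p)) (ε / 2) (by positivity)] with i hi1 hi2
  rw [Real.dist_eq] at hi2 ⊢
  have b1 := bound (L i) (hL i) p.toContinuousMap δ (by simpa using hp)
  have b2 := bound L0 hL0 p.toContinuousMap δ (by simpa using hp)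
  have c1 : δ * L i 1 < ε / 4 := by
    have : δ * L i 1 < δ * (L0 1 + 1) := by gcongr
    have e : δ * (L0 1 + 1) = ε / 4 := by rw [hδ]; field_simp
    linarith
  have c2 : δ * L0 1 < ε / 4 := by
    have : δ * L0 1 < δ * (L0 1 + 1) := by gcongr; linarith
    have e : δ * (L0 1 + 1) = ε / 4 := by rw [hδ]; field_simp
    linarith
  rw [abs_le] at b1 b2
  rw [abs_lt] at hi2 ⊢
  constructor <;> linarith [b1.1, b1.2, b2.1, b2.2, hi2.1, hi2.2]

lemma cont_bdd (g : C(ℝ, ℝ)) : ∃ M : ℝ, ∀ x ∈ Icc (0:ℝ) 1, |g x| ≤ M := by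
  obtain ⟨M, hM⟩ := isCompact_Icc.exists_bound_of_continuousOn (s := Icc (0:ℝ) 1) g.continuous.continuousOn
  exact ⟨M, hM⟩

/-- weighted sum functional -/
noncomputable def sumFun (q y : ℕ → ℝ) (hq : ∀ j, 0 ≤ q j) (hy : ∀ j, y j ∈ Icc (0:ℝ) 1)
    (hs : Summable q) : C(ℝ, ℝ) →ₗ[ℝ] ℝ :=
  have hsg : ∀ g : C(ℝ, ℝ), Summable fun j => q j * g (y j) := fun g => by
    obtain ⟨M, hM⟩ := cont_bdd g
    refine Summable.of_norm_bounded (hs.mul_right M) fun j => ?_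
    rw [norm_mul, Real.norm_of_nonneg (hq j)]
    exact mul_le_mul_of_nonneg_left (hM _ (hy j)) (hq j)
  { toFun := fun g => ∑' j, q j * g (y j)
    map_add' := fun f g => by
      simp only [ContinuousMap.add_apply, mul_add]
      exact (hsg f).tsum_add (hsg g)
    map_smul' := fun c f => by
      simp only [ContinuousMap.smul_apply, smul_eq_mul, RingHom.id_apply]
      rw [← tsum_mul_left]
      congr 1; ext j; ring }

lemma sumFun_summable {q y : ℕ → ℝ} (hq : ∀ j, 0 ≤ q j) (hy : ∀ j, y j ∈ Icc (0:ℝ) 1)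
    (hs : Summable q) (g : C(ℝ, ℝ)) : Summable fun j => q j * g (y j) := by
  obtain ⟨M, hM⟩ := cont_bdd g
  refine Summable.of_norm_bounded (hs.mul_right M) fun j => ?_
  rw [norm_mul, Real.norm_of_nonneg (hq j)]
  exact mul_le_mul_of_nonneg_left (hM _ (hy j)) (hq j)

lemma gammaFun_integrable {α : ℝ} (hα : 0 < α) (g : C(ℝ, ℝ)) :
    IntegrableOn (fun t : ℝ => (Real.exp (-t) * t ^ (α - 1)) * g (Real.exp (-t))) (Ioi 0) := by
  obtain ⟨M, hM⟩ := cont_bdd g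
  refine (Integrable.mul_const (Real.GammaIntegral_convergent hα) M).mono' ?_ ?_
  · refine Measurable.aestronglyMeasurable ?_
    have := g.continuous.measurable
    fun_prop
  · refine (ae_restrict_iff' measurableSet_Ioi).2 (Eventually.of_forall fun t ht => ?_)
    have ht : 0 < t := ht
    rw [norm_mul, Real.norm_of_nonneg (by positivity)]
    exact mul_le_mul_of_nonneg_left (hM _ ⟨by positivity, by simpa using ht.le⟩) (by positivity)

/-- limit functional -/
noncomputable def gammaFun (α : ℝ) (hα : 0 < α) : C(ℝ, ℝ) →ₗ[ℝ] ℝ :=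
  { toFun := fun g => ∫ t in Ioi (0:ℝ), (Real.exp (-t) * t ^ (α - 1)) * g (Real.exp (-t))
    map_add' := fun f g => by
      simp only [ContinuousMap.add_apply, mul_add]
      exact integral_add (gammaFun_integrable hα f) (gammaFun_integrable hα g)
    map_smul' := fun c f => by
      simp only [ContinuousMap.smul_apply, smul_eq_mul, RingHom.id_apply]
      rw [← integral_const_mul]
      congr 1; ext j; ring }

/-- test function -/
noncomputable def testFun (a b : ℝ) : C(ℝ, ℝ) where
  toFun x := max 0 (min 1 ((b + Real.log (max x (Real.exp (-b)))) / (b - a))) / max x (Real.exp (-b))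
  continuous_toFun := by
    have hpos : ∀ x : ℝ, max x (Real.exp (-b)) ≠ 0 := fun x =>
      (lt_max_of_lt_right (Real.exp_pos _)).ne'
    have h1 : Continuous fun x : ℝ => max x (Real.exp (-b)) := by fun_prop
    exact (continuous_const.max (continuous_const.min
      ((continuous_const.add (h1.log hpos)).div_const _))).div h1 hpos

lemma testFun_nonneg (a b x : ℝ) : 0 ≤ testFun a b x := by
  change 0 ≤ max 0 (min 1 ((b + Real.log (max x (Real.exp (-b)))) / (b - a))) / max x (Real.exp (-b))
  positivity

lemma testFun_le {a b : ℝ} (t : ℝ) : Real.exp (-t) * testFun a b (Real.exp (-t)) ≤ 1 := by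
  change Real.exp (-t) * (max 0 (min 1 _) / max (Real.exp (-t)) (Real.exp (-b))) ≤ 1
  rw [← mul_div_assoc, div_le_one (lt_max_of_lt_right (Real.exp_pos _))]
  refine le_trans ?_ (le_max_left _ _)
  refine mul_le_of_le_one_right (by positivity) ?_
  exact max_le zero_le_one (min_le_left _ _)

lemma testFun_one {a b : ℝ} (hab : a < b) {t : ℝ} (ht : t ≤ a) :
    Real.exp (-t) * testFun a b (Real.exp (-t)) = 1 := by
  change Real.exp (-t) * (max 0 (min 1 ((b + Real.log (max (Real.exp (-t)) (Real.exp (-b)))) / (b - a))) / max (Real.exp (-t)) (Real.exp (-b))) = 1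
  rw [max_eq_left (Real.exp_le_exp.2 (by linarith)), Real.log_exp, min_eq_left, max_eq_right zero_le_one,
    mul_one_div, div_self (Real.exp_pos _).ne']
  rw [le_div_iff₀ (by linarith)]; linarith

lemma testFun_zero {a b : ℝ} {t : ℝ} (ht : b ≤ t) :
    testFun a b (Real.exp (-t)) = 0 := by
  change (max 0 (min 1 ((b + Real.log (max (Real.exp (-t)) (Real.exp (-b)))) / (b - a))) / max (Real.exp (-t)) (Real.exp (-b))) = 0
  rw [max_eq_right (Real.exp_le_exp.2 (by linarith)), Real.log_exp]
  simp

lemma int_rpow_Ioc {α : ℝ} (hα : 0 < α) {a : ℝ} (ha : 0 ≤ a) :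
    ∫ t in Ioc (0:ℝ) a, t ^ (α - 1) = a ^ α / α := by
  rw [← intervalIntegral.integral_of_le ha, integral_rpow (Or.inl (by linarith))]
  simp [Real.zero_rpow hα.ne']

lemma int_rpow_Ioc_integrable {α : ℝ} (hα : 0 < α) {a : ℝ} (ha : 0 ≤ a) :
    IntegrableOn (fun t : ℝ => t ^ (α - 1)) (Ioc (0:ℝ) a) := by
  rw [← intervalIntegrable_iff_integrableOn_Ioc_of_le ha]
  exact intervalIntegral.intervalIntegrable_rpow' (by linarith)

lemma gammaFun_test_le {α : ℝ} (hα : 0 < α) {a b : ℝ} (hb : 0 ≤ b) :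
    gammaFun α hα (testFun a b) ≤ b ^ α / α := by
  change (∫ t in Ioi (0:ℝ), (Real.exp (-t) * t ^ (α - 1)) * testFun a b (Real.exp (-t))) ≤ _
  rw [← int_rpow_Ioc hα hb, ← integral_indicator measurableSet_Ioc, ← integral_indicator measurableSet_Ioi]
  refine integral_mono ((gammaFun_integrable hα _).integrable_indicator measurableSet_Ioi)
    ((int_rpow_Ioc_integrable hα hb).integrable_indicator measurableSet_Ioc) fun t => ?_
  by_cases ht : t ∈ Ioi (0:ℝ)
  · have ht0 : 0 < t := ht
    rw [indicator_of_mem ht]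
    by_cases ht2 : t ∈ Ioc (0:ℝ) b
    · rw [indicator_of_mem ht2]
      have := testFun_le (a := a) (b := b) t
      have h2 : 0 ≤ t ^ (α - 1) := by positivity
      nlinarith
    · rw [indicator_of_notMem ht2, testFun_zero]
      · simp
      · by_contra! h; exact ht2 ⟨ht0, h.le⟩
  · rw [indicator_of_notMem ht, indicator_of_notMem (fun h => ht h.1)]

lemma le_gammaFun_test {α : ℝ} (hα : 0 < α) {a b : ℝ} (ha : 0 ≤ a) (hab : a < b) :
    a ^ α / α ≤ gammaFun α hα (testFun a b) := by
  change _ ≤ (∫ t in Ioi (0:ℝ), (Real.exp (-t) * t ^ (α - 1)) * testFun a b (Real.exp (-t)))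
  rw [← int_rpow_Ioc hα ha, ← integral_indicator measurableSet_Ioc, ← integral_indicator measurableSet_Ioi]
  refine integral_mono 
    ((int_rpow_Ioc_integrable hα ha).integrable_indicator measurableSet_Ioc)
    ((gammaFun_integrable hα _).integrable_indicator measurableSet_Ioi) fun t => ?_
  by_cases ht : t ∈ Ioi (0:ℝ)
  · have ht0 : 0 < t := ht
    rw [indicator_of_mem ht]
    have := testFun_nonneg a b (Real.exp (-t))
    by_cases ht2 : t ∈ Ioc (0:ℝ) a
    · rw [indicator_of_mem ht2, mul_right_comm, testFun_one hab ht2.2, one_mul]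
    · rw [indicator_of_notMem ht2]
      positivity
  · rw [indicator_of_notMem ht, indicator_of_notMem (fun h => ht h.1)]

lemma karamata {ι : Type*} {l : Filter ι} {q : ι → ℕ → ℝ} {m : ι → ℕ} {κ : ι → ℝ} {α B : ℝ}
    (hα : 0 < α) (hB : 0 ≤ B) (hq : ∀ i j, 0 ≤ q i j) (hm : ∀ i, 1 ≤ m i) (hκ : ∀ i, 0 ≤ κ i)
    (hs : ∀ i (x : ℝ), 0 < x → x < 1 → Summable fun j => q i j * x ^ j)
    (hL : ∀ k : ℕ, Tendsto (fun i => κ i * ∑' j, q i j * Real.exp (-(((k:ℝ) + 1) / m i)) ^ j) l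
      (𝓝 (B * (1 / ((k:ℝ) + 1)) ^ α))) :
    Tendsto (fun i => κ i * ∑ j ∈ Finset.range (m i + 1), q i j) l (𝓝 (B / Real.Gamma (α + 1))) := by
  have hmp : ∀ i, (0:ℝ) < m i := fun i => by exact_mod_cast hm i
  set y : ι → ℕ → ℝ := fun i j => Real.exp (-(j / m i : ℝ)) with hydef
  have hyI : ∀ i j, y i j ∈ Icc (0:ℝ) 1 := fun i j => by
    have := hmp i
    refine ⟨(Real.exp_pos _).le, ?_⟩
    rw [hydef]
    simp only [Real.exp_le_one_iff, neg_nonpos]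
    positivity
  have hys : ∀ i (j k : ℕ), y i j * y i j ^ k = Real.exp (-(((k:ℝ) + 1) / m i)) ^ j := by
    intro i j k
    rw [hydef]
    simp only
    rw [← Real.exp_nat_mul, ← Real.exp_nat_mul, ← Real.exp_add]
    congr 1; ring
  set Q : ι → ℕ → ℝ := fun i j => κ i * (q i j * y i j) with hQ
  have hQ0 : ∀ i j, 0 ≤ Q i j := fun i j =>
    mul_nonneg (hκ i) (mul_nonneg (hq i j) (hyI i j).1)
  have hQs : ∀ i, Summable (Q i) := fun i => by
    refine Summable.mul_left _ ?_
    have := hs i (Real.exp (-(((0:ℕ):ℝ) + 1) / m i)) (Real.exp_pos _) (by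
      rw [Real.exp_lt_one_iff, neg_div, neg_lt_zero]; have := hmp i; positivity)
    refine this.congr fun j => ?_
    rw [neg_div, ← hys]; simp
  set L0 : C(ℝ, ℝ) →ₗ[ℝ] ℝ := (B / Real.Gamma α) • gammaFun α hα with hL0
  have hΓ : 0 < Real.Gamma α := Real.Gamma_pos_of_pos hα
  have conv := pos_fun_conv (l := l) (fun i => sumFun (Q i) (y i) (hQ0 i) (hyI i) (hQs i)) L0 ?_ ?_ ?_
  rotate_left
  · intro i f g hfg
    change ∑' j, Q i j * f (y i j) ≤ ∑' j, Q i j * g (y i j)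
    exact (sumFun_summable (hQ0 i) (hyI i) (hQs i) f).tsum_le_tsum
      (fun j => mul_le_mul_of_nonneg_left (hfg _ (hyI i j)) (hQ0 i j))
      (sumFun_summable (hQ0 i) (hyI i) (hQs i) g)
  · intro f g hfg
    simp only [hL0, LinearMap.smul_apply, smul_eq_mul]
    refine mul_le_mul_of_nonneg_left ?_ (by positivity)
    change (∫ t in Ioi (0:ℝ), (Real.exp (-t) * t ^ (α - 1)) * f (Real.exp (-t))) ≤
      ∫ t in Ioi (0:ℝ), (Real.exp (-t) * t ^ (α - 1)) * g (Real.exp (-t))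
    refine setIntegral_mono_on (gammaFun_integrable hα f) (gammaFun_integrable hα g) measurableSet_Ioi
      fun t ht => ?_
    have ht : 0 < t := ht
    exact mul_le_mul_of_nonneg_left (hfg _ ⟨by positivity, by simpa using ht.le⟩) (by positivity)
  · intro k
    have e0 : L0 (ContinuousMap.id ℝ ^ k) = B * (1 / ((k:ℝ) + 1)) ^ α := by
      have : gammaFun α hα (ContinuousMap.id ℝ ^ k) = (1 / ((k:ℝ) + 1)) ^ α * Real.Gamma α := by
        rw [← Real.integral_rpow_mul_exp_neg_mul_Ioi hα (by positivity : 0 < (k:ℝ) + 1)]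
        change (∫ t in Ioi (0:ℝ), (Real.exp (-t) * t ^ (α - 1)) * _) = _
        refine setIntegral_congr_fun measurableSet_Ioi fun t ht => ?_
        simp only [ContinuousMap.pow_apply, ContinuousMap.id_apply]
        rw [mul_right_comm, ← Real.exp_nat_mul, ← Real.exp_add, mul_comm]
        congr 2; ring
      rw [hL0, LinearMap.smul_apply, this, smul_eq_mul]
      field_simp
    rw [e0]
    refine (hL k).congr fun i => ?_
    change _ = ∑' j, Q i j * _
    rw [← tsum_mul_left]
    congr 1; ext j
    simp only [ContinuousMap.pow_apply, ContinuousMap.id_apply, hQ]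
    rw [← hys]; ring
  have hΓ1 : Real.Gamma (α + 1) = α * Real.Gamma α := Real.Gamma_add_one hα.ne'
  have hcont : Tendsto (fun b : ℝ => B / Real.Gamma (α + 1) * b ^ α) (𝓝 1) (𝓝 (B / Real.Gamma (α + 1))) := by
    have h1 : ContinuousAt (fun b : ℝ => B / Real.Gamma (α + 1) * b ^ α) 1 :=
      continuousAt_const.mul (Real.continuousAt_rpow_const 1 α (Or.inl one_ne_zero))
    simpa [ContinuousAt] using h1
  rw [tendsto_order]
  constructor
  · intro u hu
    obtain ⟨a, ⟨ha1, ha2⟩, ha3⟩ := (((hcont.mono_left nhdsWithin_le_nhds).eventually (lt_mem_nhds hu)).and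
      (nhdsWithin_le_nhds (lt_mem_nhds one_pos)) |>.and (self_mem_nhdsWithin (a := (1:ℝ)) (s := Iio 1))).exists
    have ha3 : a < 1 := ha3
    have h1 : u < L0 (testFun a 1) := by
      refine lt_of_lt_of_le ha1 ?_
      rw [hL0, LinearMap.smul_apply, smul_eq_mul]
      have := le_gammaFun_test hα ha2.le ha3
      calc B / Real.Gamma (α + 1) * a ^ α = B / Real.Gamma α * (a ^ α / α) := by rw [hΓ1]; field_simp
        _ ≤ _ := by gcongr
    filter_upwards [(conv (testFun a 1)).eventually (lt_mem_nhds h1)] with i hi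
    refine hi.trans_le ?_
    change ∑' j, Q i j * testFun a 1 (y i j) ≤ _
    rw [tsum_eq_sum (s := Finset.range (m i + 1)), Finset.mul_sum]
    · refine Finset.sum_le_sum fun j _ => ?_
      simp only [hQ]
      rw [mul_assoc, mul_assoc]
      refine mul_le_mul_of_nonneg_left ?_ (hκ i)
      exact mul_le_of_le_one_right (hq i j) (testFun_le _)
    · intro j hj
      rw [Finset.mem_range] at hj
      rw [hydef]
      simp only
      rw [testFun_zero, mul_zero]
      rw [le_div_iff₀ (hmp i), one_mul]
      exact_mod_cast (by omega : m i ≤ j)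
  · intro u hu
    obtain ⟨b, ha1, ha3⟩ := (((hcont.mono_left nhdsWithin_le_nhds).eventually (gt_mem_nhds hu)).and
      (self_mem_nhdsWithin (a := (1:ℝ)) (s := Ioi 1))).exists
    have ha3 : 1 < b := ha3
    have h1 : L0 (testFun 1 b) < u := by
      refine lt_of_le_of_lt ?_ ha1
      rw [hL0, LinearMap.smul_apply, smul_eq_mul]
      have := gammaFun_test_le hα (a := 1) (b := b) (by linarith)
      calc _ ≤ B / Real.Gamma α * (b ^ α / α) := by gcongr
        _ = B / Real.Gamma (α + 1) * b ^ α := by rw [hΓ1]; field_simp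
    filter_upwards [(conv (testFun 1 b)).eventually (gt_mem_nhds h1)] with i hi
    refine lt_of_le_of_lt ?_ hi
    change _ ≤ ∑' j, Q i j * testFun 1 b (y i j)
    have hsum := (sumFun_summable (hQ0 i) (hyI i) (hQs i) (testFun 1 b))
    refine le_trans ?_ (hsum.sum_le_tsum (Finset.range (m i + 1))
      (fun j _ => mul_nonneg (hQ0 i j) (testFun_nonneg _ _ _)))
    rw [Finset.mul_sum]
    refine Finset.sum_le_sum fun j hj => le_of_eq ?_
    rw [Finset.mem_range] at hj
    simp only [hQ]
    rw [mul_assoc, mul_assoc, hydef]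
    simp only
    rw [testFun_one ha3, mul_one]
    rw [div_le_one (hmp i)]
    exact_mod_cast (by omega : j ≤ m i)

lemma ennreal_tsum_antidiag (f : ℕ × ℕ → ℝ≥0∞) :
    ∑' n, ∑ p ∈ Finset.HasAntidiagonal.antidiagonal n, f p = ∑' p, f p := by
  rw [← Equiv.tsum_eq Finset.HasAntidiagonal.sigmaAntidiagonalEquivProd f, ENNReal.tsum_sigma']
  congr 1; ext n
  rw [tsum_fintype, ← Finset.sum_coe_sort]
  rfl

/-- one member of the renewal family -/
structure RenewalData (q p : ℕ → ℝ) (r : ℕ → ℕ → ℝ) : Prop where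
  q0 : ∀ j, 0 ≤ q j
  qM : ∃ M, ∀ j, q j ≤ M
  p0 : ∀ j, 0 ≤ p j
  p1 : ∀ j, p j ≤ 1
  r0 : ∀ k j, 0 ≤ r k j
  ren : ∀ s, ∑ a ∈ Finset.HasAntidiagonal.antidiagonal s, r a.1 a.2 = 1

lemma geom_summable_bdd {x M : ℝ} {f : ℕ → ℝ} (hx0 : 0 < x) (hx1 : x < 1) (h0 : ∀ j, 0 ≤ f j)
    (hM : ∀ j, f j ≤ M) : Summable fun j => f j * x ^ j := by
  refine Summable.of_nonneg_of_le (fun j => mul_nonneg (h0 j) (by positivity)) (fun j => ?_)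
    ((summable_geometric_of_lt_one hx0.le hx1).mul_left M)
  exact mul_le_mul_of_nonneg_right (hM j) (by positivity)

section
variable {q p : ℕ → ℝ} {r : ℕ → ℕ → ℝ}

lemma RenewalData.r1 (h : RenewalData q p r) (k j : ℕ) : r k j ≤ 1 := by
  rw [← h.ren (k + j)]
  exact Finset.single_le_sum (f := fun a : ℕ × ℕ => r a.1 a.2) (fun a _ => h.r0 _ _)
    (Finset.HasAntidiagonal.mem_antidiagonal.2 (show (k, j).1 + (k, j).2 = k + j from rfl))

lemma RenewalData.sum0 (h : RenewalData q p r) (N j : ℕ) : 0 ≤ ∑ k ∈ Finset.range N, r k j :=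
  Finset.sum_nonneg fun k _ => h.r0 k j

lemma RenewalData.sumle (h : RenewalData q p r) (N j : ℕ) : ∑ k ∈ Finset.range N, r k j ≤ N := by
  have := Finset.sum_le_card_nsmul (Finset.range N) (fun k => r k j) 1 (fun k _ => h.r1 k j)
  simpa using this

lemma RenewalData.sumE (h : RenewalData q p r) {x : ℝ} (hx0 : 0 < x) (hx1 : x < 1) (N : ℕ) :
    Summable fun j => (∑ k ∈ Finset.range N, r k j) * x ^ j :=
  geom_summable_bdd hx0 hx1 (h.sum0 N) (h.sumle N)

lemma RenewalData.sumq (h : RenewalData q p r) {x : ℝ} (hx0 : 0 < x) (hx1 : x < 1) :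
    Summable fun j => q j * x ^ j := by
  obtain ⟨M, hM⟩ := h.qM
  exact geom_summable_bdd hx0 hx1 h.q0 hM

lemma RenewalData.sump (h : RenewalData q p r) {x : ℝ} (hx0 : 0 < x) (hx1 : x < 1) :
    Summable fun j => p j * x ^ j := geom_summable_bdd hx0 hx1 h.p0 h.p1

lemma RenewalData.hasSum (h : RenewalData q p r) {x : ℝ} (hx0 : 0 < x) (hx1 : x < 1) :
    HasSum (fun N : ℕ => x ^ N * ∑' j, (∑ k ∈ Finset.range (N + 1), r k j) * x ^ j)
      (1 / (1 - x) ^ 2) := by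
  have hpos : ∀ N : ℕ, 0 ≤ x ^ N * ∑' j, (∑ k ∈ Finset.range (N + 1), r k j) * x ^ j := fun N =>
    mul_nonneg (by positivity) (tsum_nonneg fun j => mul_nonneg (h.sum0 _ j) (by positivity))
  set X := ENNReal.ofReal x with hX
  set ρ : ℕ → ℕ → ℝ≥0∞ := fun k j => ENNReal.ofReal (r k j) with hρ
  have hgeo : ∑' i : ℕ, X ^ i = ENNReal.ofReal (1 / (1 - x)) := by
    rw [one_div, ← tsum_geometric_of_lt_one hx0.le hx1, ENNReal.ofReal_tsum_of_nonneg
      (fun i => by positivity) (summable_geometric_of_lt_one hx0.le hx1)]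
    simp [hX, ENNReal.ofReal_pow hx0.le]
  have e1 : ∀ N : ℕ, ENNReal.ofReal (x ^ N * ∑' j, (∑ k ∈ Finset.range (N + 1), r k j) * x ^ j) =
      ∑' j, ∑ a ∈ Finset.HasAntidiagonal.antidiagonal N, X ^ a.2 * (X ^ (a.1 + j) * ρ a.1 j) := by
    intro N
    rw [ENNReal.ofReal_mul (by positivity), ENNReal.ofReal_tsum_of_nonneg
      (fun j => mul_nonneg (h.sum0 _ j) (by positivity)) (h.sumE hx0 hx1 _), ← ENNReal.tsum_mul_left]
    congr 1; ext j
    rw [Finset.Nat.sum_antidiagonal_eq_sum_range_succ_mk, ENNReal.ofReal_mul (h.sum0 _ j),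
      ENNReal.ofReal_sum_of_nonneg (fun k _ => h.r0 k j), ENNReal.ofReal_pow hx0.le,
      ENNReal.ofReal_pow hx0.le, Finset.sum_mul, Finset.mul_sum]
    refine Finset.sum_congr rfl fun k hk => ?_
    have : k ≤ N := by simp at hk; omega
    obtain ⟨i, rfl⟩ := Nat.exists_eq_add_of_le this
    simp only [add_tsub_cancel_left, pow_add]
    ring
  have e2 : ∑' N : ℕ, ENNReal.ofReal (x ^ N * ∑' j, (∑ k ∈ Finset.range (N + 1), r k j) * x ^ j) =
      ENNReal.ofReal (1 / (1 - x) ^ 2) := by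
    simp_rw [e1]
    rw [ENNReal.tsum_comm]
    simp_rw [fun j : ℕ => ennreal_tsum_antidiag (fun a : ℕ × ℕ => X ^ a.2 * (X ^ (a.1 + j) * ρ a.1 j)),
      fun j : ℕ => ENNReal.tsum_prod (f := fun k i : ℕ => X ^ i * (X ^ (k + j) * ρ k j)),
      ENNReal.tsum_mul_right, hgeo, ENNReal.tsum_mul_left]
    rw [ENNReal.tsum_comm, ← ENNReal.tsum_prod (f := fun k j : ℕ => X ^ (k + j) * ρ k j),
      ← ennreal_tsum_antidiag]
    have : ∀ s : ℕ, ∑ a ∈ Finset.HasAntidiagonal.antidiagonal s, X ^ (a.1 + a.2) * ρ a.1 a.2 = X ^ s := by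
      intro s
      calc ∑ a ∈ Finset.HasAntidiagonal.antidiagonal s, X ^ (a.1 + a.2) * ρ a.1 a.2
          = ∑ a ∈ Finset.HasAntidiagonal.antidiagonal s, X ^ s * ρ a.1 a.2 :=
            Finset.sum_congr rfl fun a ha => by rw [Finset.HasAntidiagonal.mem_antidiagonal.1 ha]
        _ = X ^ s := by
            rw [← Finset.mul_sum, hρ]
            simp only
            rw [← ENNReal.ofReal_sum_of_nonneg (fun a _ => h.r0 _ _), h.ren]; simp
    simp_rw [this, hgeo]
    have h1x : 0 < 1 - x := by linarith
    rw [← ENNReal.ofReal_mul (by positivity)]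
    congr 1; field_simp
  have hsum : Summable (fun N : ℕ => x ^ N * ∑' j, (∑ k ∈ Finset.range (N + 1), r k j) * x ^ j) := by
    have := ENNReal.summable_toReal (f := fun N : ℕ => ENNReal.ofReal
      (x ^ N * ∑' j, (∑ k ∈ Finset.range (N + 1), r k j) * x ^ j)) (by rw [e2]; exact ENNReal.ofReal_ne_top)
    exact this.congr fun N => ENNReal.toReal_ofReal (hpos N)
  rw [← ENNReal.ofReal_tsum_of_nonneg hpos hsum, ENNReal.ofReal_eq_ofReal_iff (tsum_nonneg hpos) (by positivity)] at e2
  rw [← e2]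
  exact hsum.hasSum

lemma RenewalData.sweep (h : RenewalData q p r) {x : ℝ} (hx0 : 0 < x) (hx1 : x < 1) {w1 C ε : ℝ} {K N : ℕ}
    (hC : 0 ≤ C) (hw : 0 < w1) (hK : 1 ≤ 2 * x ^ K)
    (hε : C * (K + 1) * 2 * ε ≤ 1 / 2)
    (hsw : ∀ i, p i ≤ C * ∑ l ∈ Finset.range (K + 1), (∑ k ∈ Finset.range N, r k (i + l)) / w1)
    (hap : ∀ j, (∑ k ∈ Finset.range N, r k j) / w1 ≤ q j + ε * p j) :
    ∑' j, p j * x ^ j ≤ 4 * C * (K + 1) * ∑' j, q j * x ^ j := by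
  set P := ∑' j, p j * x ^ j
  set Q := ∑' j, q j * x ^ j
  set e : ℕ → ℝ := fun j => (∑ k ∈ Finset.range N, r k j) / w1 with he
  have he0 : ∀ j, 0 ≤ e j := fun j => div_nonneg (h.sum0 _ j) hw.le
  have hes : Summable fun j => e j * x ^ j := by
    refine ((h.sumE hx0 hx1 N).div_const w1).congr fun j => ?_
    simp only [he]; ring
  have hP : 0 ≤ P := tsum_nonneg fun j => mul_nonneg (h.p0 j) (by positivity)
  set E := ∑' j, e j * x ^ j
  have h1 : E ≤ Q + ε * P := by
    rw [← tsum_mul_left, ← (h.sumq hx0 hx1).tsum_add ((h.sump hx0 hx1).mul_left ε)]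
    refine hes.tsum_le_tsum (fun j => ?_) ((h.sumq hx0 hx1).add ((h.sump hx0 hx1).mul_left ε))
    have := mul_le_mul_of_nonneg_right (hap j) (show 0 ≤ x ^ j by positivity)
    linarith
  have hshift : ∀ l ∈ Finset.range (K + 1), Summable (fun i => e (i + l) * x ^ i) ∧
      ∑' i, e (i + l) * x ^ i ≤ 2 * E := by
    intro l hl
    have hl : l ≤ K := by simp at hl; omega
    have hs1 : Summable fun i => e (i + l) * x ^ (i + l) :=
      (summable_nat_add_iff (f := fun j => e j * x ^ j) l).2 hes
    have hle : ∀ i, e (i + l) * x ^ i ≤ 2 * (e (i + l) * x ^ (i + l)) := by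
      intro i
      have h3 : x ^ K ≤ x ^ l := pow_le_pow_of_le_one hx0.le hx1.le hl
      have h4 : 0 ≤ e (i + l) * x ^ i := mul_nonneg (he0 _) (by positivity)
      rw [pow_add]
      nlinarith
    have hs2 : Summable (fun i => e (i + l) * x ^ i) :=
      Summable.of_nonneg_of_le (fun i => mul_nonneg (he0 _) (by positivity)) hle (hs1.mul_left 2)
    refine ⟨hs2, (hs2.tsum_le_tsum hle (hs1.mul_left 2)).trans ?_⟩
    rw [tsum_mul_left]
    have h5 := hes.sum_add_tsum_nat_add l
    have h6 : 0 ≤ ∑ i ∈ Finset.range l, e i * x ^ i :=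
      Finset.sum_nonneg fun i _ => mul_nonneg (he0 _) (by positivity)
    have : ∑' i, e (i + l) * x ^ (i + l) ≤ E := by linarith
    linarith
  have h2 : P ≤ C * ((K + 1) * (2 * E)) := by
    have hs : Summable fun i => ∑ l ∈ Finset.range (K + 1), e (i + l) * x ^ i :=
      summable_sum fun l hl => (hshift l hl).1
    have : P ≤ ∑' i, C * ∑ l ∈ Finset.range (K + 1), e (i + l) * x ^ i := by
      refine (h.sump hx0 hx1).tsum_le_tsum (fun i => ?_) (hs.mul_left C)
      have := mul_le_mul_of_nonneg_right (hsw i) (show 0 ≤ x ^ i by positivity)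
      rwa [mul_assoc, Finset.sum_mul] at this
    refine this.trans ?_
    rw [tsum_mul_left, Summable.tsum_finsetSum (fun l hl => (hshift l hl).1)]
    refine mul_le_mul_of_nonneg_left ?_ hC
    have := Finset.sum_le_card_nsmul (Finset.range (K + 1)) (fun l => ∑' i, e (i + l) * x ^ i) (2 * E)
      (fun l hl => (hshift l hl).2)
    simpa using this
  have h3 : C * ((K + 1) * (2 * E)) ≤ C * ((K + 1) * (2 * (Q + ε * P))) := by gcongr
  nlinarith

end

lemma renewal_laplace {ι : Type*} {l : Filter ι} {q p : ι → ℕ → ℝ} {r : ι → ℕ → ℕ → ℝ}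
    {w : ℕ → ℝ} (hwm : Monotone w) (hw1 : 0 < w 1)
    (hd : ∀ i, RenewalData (q i) (p i) (r i)) {C : ℝ} {K N0 : ℕ} (hC : 0 ≤ C)
    (hsw : ∀ N, N0 ≤ N → ∀ i a, p i a ≤
      C * ∑ t ∈ Finset.range (K + 1), (∑ k ∈ Finset.range N, r i k (a + t)) / w N)
    (hap : ∀ ε : ℝ, 0 < ε → ∃ N1, ∀ N, N1 ≤ N → ∀ i j,
      |(∑ k ∈ Finset.range N, r i k j) / w N - q i j| ≤ ε * p i j)
    {x : ι → ℝ} (hx0 : ∀ i, 0 < x i) (hx1 : ∀ i, x i < 1) (hxl : Tendsto x l (𝓝 1))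
    (hws : ∀ y : ℝ, 0 < y → y < 1 → Summable fun N => y ^ N * w (N + 1)) :
    Tendsto (fun i => (∑' j, q i j * x i ^ j) * (∑' N, x i ^ N * w (N + 1)) * (1 - x i) ^ 2) l
      (𝓝 1) := by
  -- constants
  set C2 : ℝ := 4 * C * (K + 1) with hC2
  have hC2n : 0 ≤ C2 := by positivity
  have hwp : ∀ N, 1 ≤ N → 0 < w N := fun N hN => hw1.trans_le (hwm hN)
  have hsweep : ∀ᶠ i in l, ∑' j, p i j * x i ^ j ≤ C2 * ∑' j, q i j * x i ^ j := by
    obtain ⟨N1, hN1⟩ := hap (1 / (4 * (C * (K + 1) + 1))) (by positivity)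
    set N := max 1 (max N0 N1) with hN
    have hK : ∀ᶠ i in l, 1 ≤ 2 * x i ^ K := by
      have := ((hxl.pow K).const_mul 2)
      rw [one_pow, mul_one] at this
      filter_upwards [this.eventually (lt_mem_nhds (show (1:ℝ) < 2 by norm_num))] with i hi
      exact hi.le
    filter_upwards [hK] with i hi
    refine (hd i).sweep (hx0 i) (hx1 i) hC (hwp N (le_max_left _ _)) hi
      (ε := 1 / (4 * (C * (K + 1) + 1))) ?_ (hsw N (by omega) i) ?_
    · have : 0 ≤ C * ((K:ℝ) + 1) := by positivity
      rw [mul_one_div, div_le_div_iff₀ (by positivity) (by norm_num)]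
      linarith
    · intro j
      have := (abs_le.1 (hN1 N (by omega) i j)).2
      linarith
  -- main estimate
  have main : ∀ η : ℝ, 0 < η → ∃ D : ℝ, ∀ᶠ i in l,
      |1 / (1 - x i) ^ 2 - (∑' j, q i j * x i ^ j) * (∑' N, x i ^ N * w (N + 1))| ≤
        (η * (∑' N, x i ^ N * w (N + 1)) + D) * (∑' j, q i j * x i ^ j) := by
    intro η hη
    obtain ⟨N1, hN1⟩ := hap (min η 1 / (C2 + 1)) (by positivity)
    set N2 := max 1 N1 with hN2
    refine ⟨N2 * (2 * w N2), ?_⟩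
    filter_upwards [hsweep] with i hi
    set Q := ∑' j, q i j * x i ^ j with hQ
    set P := ∑' j, p i j * x i ^ j with hP
    have hx0 := hx0 i
    have hx1 := hx1 i
    have hQ0 : 0 ≤ Q := tsum_nonneg fun j => mul_nonneg ((hd i).q0 j) (by positivity)
    set E : ℕ → ℝ := fun N => ∑' j, (∑ k ∈ Finset.range N, r i k j) * x i ^ j with hE
    have hEm : Monotone E := by
      intro a b hab
      refine ((hd i).sumE hx0 hx1 a).tsum_le_tsum (fun j => ?_) ((hd i).sumE hx0 hx1 b)
      refine mul_le_mul_of_nonneg_right ?_ (by positivity)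
      exact Finset.sum_le_sum_of_subset_of_nonneg (Finset.range_subset_range.2 hab)
        (fun k _ _ => (hd i).r0 k j)
    have hE0 : ∀ N, 0 ≤ E N := fun N => tsum_nonneg fun j => mul_nonneg ((hd i).sum0 _ j) (by positivity)
    have hEN : ∀ N, N2 ≤ N → |E N - w N * Q| ≤ min η 1 * (w N * Q) := by
      intro N hN
      have hwN := hwp N (by omega)
      have e1 : E N - w N * Q = ∑' j, w N * ((∑ k ∈ Finset.range N, r i k j) / w N - q i j) * x i ^ j := by
        rw [hE, hQ, ← tsum_mul_left]
        simp only
        rw [← ((hd i).sumE hx0 hx1 N).tsum_sub (((hd i).sumq hx0 hx1).mul_left _)]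
        congr 1; ext j
        field_simp
      have hb : ∀ j, ‖w N * ((∑ k ∈ Finset.range N, r i k j) / w N - q i j) * x i ^ j‖ ≤
          (w N * (min η 1 / (C2 + 1))) * (p i j * x i ^ j) := by
        intro j
        rw [norm_mul, norm_mul, Real.norm_of_nonneg hwN.le, Real.norm_of_nonneg (show 0 ≤ x i ^ j by positivity),
          Real.norm_eq_abs]
        have := hN1 N (by omega) i j
        calc _ ≤ w N * (min η 1 / (C2 + 1) * p i j) * x i ^ j := by gcongr
          _ = _ := by ring
      have hs := ((hd i).sump hx0 hx1).mul_left (w N * (min η 1 / (C2 + 1)))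
      rw [e1, ← Real.norm_eq_abs]
      refine (tsum_of_norm_bounded hs.hasSum hb).trans ?_
      rw [tsum_mul_left]
      calc w N * (min η 1 / (C2 + 1)) * P ≤ w N * (min η 1 / (C2 + 1)) * (C2 * Q) := by gcongr
        _ = (min η 1) * (w N * Q) * (C2 / (C2 + 1)) := by ring
        _ ≤ (min η 1) * (w N * Q) * 1 := by
            have : C2 / (C2 + 1) ≤ 1 := by rw [div_le_one (by positivity)]; linarith
            gcongr
        _ = _ := by ring
    have hall : ∀ N : ℕ, |E (N + 1) - w (N + 1) * Q| ≤
        η * (w (N + 1) * Q) + (if N < N2 then 2 * w N2 * Q else 0) := by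
      intro N
      have hwN := hwp (N + 1) (by omega)
      have hwQ : 0 ≤ w (N + 1) * Q := by positivity
      by_cases h : N < N2
      · rw [if_pos h]
        have a1 := hEm (show N + 1 ≤ N2 by omega)
        have a2 := hEN N2 le_rfl
        have a3 : w (N + 1) * Q ≤ w N2 * Q := mul_le_mul_of_nonneg_right (hwm (by omega)) hQ0
        have a4 : 0 ≤ w N2 * Q := by linarith
        have a5 : min η 1 * (w N2 * Q) ≤ 1 * (w N2 * Q) := by gcongr; exact min_le_right _ _
        have a6 := (abs_le.1 a2).2
        have a7 := hE0 (N + 1)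
        have a8 : 0 ≤ η * (w (N + 1) * Q) := by positivity
        rw [abs_le]; constructor <;> linarith
      · rw [if_neg h, add_zero]
        refine (hEN (N + 1) (by omega)).trans ?_
        gcongr; exact min_le_left _ _
    have hS := (hd i).hasSum hx0 hx1
    have hW := hws (x i) hx0 hx1
    have e2 : 1 / (1 - x i) ^ 2 - Q * (∑' N, x i ^ N * w (N + 1)) =
        ∑' N, x i ^ N * (E (N + 1) - w (N + 1) * Q) := by
      rw [← hS.tsum_eq, ← tsum_mul_left, ← hS.summable.tsum_sub (hW.mul_left Q)]
      congr 1; ext N; ring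
    have hfin : HasSum (fun N : ℕ => if N < N2 then 2 * w N2 * Q else 0) (N2 * (2 * w N2 * Q)) := by
      have := hasSum_sum_of_ne_finset_zero (L := SummationFilter.unconditional ℕ) (f := fun N : ℕ => if N < N2 then 2 * w N2 * Q else 0)
        (s := Finset.range N2) (fun N hN => by simp at hN; simp; omega)
      convert this using 1
      rw [Finset.sum_congr rfl (g := fun _ => 2 * w N2 * Q) (fun N hN => by
        rw [if_pos (Finset.mem_range.1 hN)])]
      simp
    rw [e2, ← Real.norm_eq_abs]
    refine (tsum_of_norm_bounded ((hW.hasSum.mul_left (η * Q)).add hfin) fun N => ?_).trans (le_of_eq (by ring))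
    rw [norm_mul, Real.norm_of_nonneg (show 0 ≤ x i ^ N by positivity), Real.norm_eq_abs]
    have hx1' : x i ^ N ≤ 1 := pow_le_one₀ hx0.le hx1.le
    have hx0' : 0 ≤ x i ^ N := by positivity
    have hif : 0 ≤ (if N < N2 then 2 * w N2 * Q else 0) := by
      have := hwp N2 (by omega)
      split_ifs <;> positivity
    have := mul_le_mul_of_nonneg_left (hall N) hx0'
    nlinarith
  -- W → ∞
  have hWinf : Tendsto (fun i => ∑' N, x i ^ N * w (N + 1)) l atTop := by
    have h1 : Tendsto (fun i => w 1 * (1 - x i)⁻¹) l atTop := by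
      refine Tendsto.const_mul_atTop hw1 (tendsto_inv_nhdsGT_zero.comp ?_)
      refine tendsto_nhdsWithin_iff.2 ⟨?_, Eventually.of_forall fun i => by simpa using hx1 i⟩
      simpa using hxl.const_sub 1
    refine tendsto_atTop_mono (fun i => ?_) h1
    rw [← tsum_geometric_of_lt_one (hx0 i).le (hx1 i), ← tsum_mul_left]
    refine ((summable_geometric_of_lt_one (hx0 i).le (hx1 i)).mul_left _).tsum_le_tsum (fun N => ?_)
      (hws _ (hx0 i) (hx1 i))
    rw [mul_comm]
    exact mul_le_mul_of_nonneg_left (hwm (by omega)) (pow_nonneg (hx0 i).le _)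
  rw [Metric.tendsto_nhds]
  intro ε hε
  set η := min (ε / 8) (1 / 8) with hη
  have hηp : 0 < η := by positivity
  obtain ⟨D, hD⟩ := main η hηp
  filter_upwards [hD, hWinf.eventually_ge_atTop (D / η), hWinf.eventually_ge_atTop 0] with i h1 h2 h2'
  set Q := ∑' j, q i j * x i ^ j with hQ
  set W := ∑' N, x i ^ N * w (N + 1)
  have hx0 := hx0 i
  have hx1 : 0 < 1 - x i := by linarith [hx1 i]
  have hQ0 : 0 ≤ Q := tsum_nonneg fun j => mul_nonneg ((hd i).q0 j) (by positivity)
  rw [div_le_iff₀ hηp] at h2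
  have h3 : |1 / (1 - x i) ^ 2 - Q * W| ≤ 2 * η * (Q * W) := by
    refine h1.trans ?_
    nlinarith
  have h4 : |1 - Q * W * (1 - x i) ^ 2| ≤ 2 * η * (Q * W * (1 - x i) ^ 2) := by
    have : 1 - Q * W * (1 - x i) ^ 2 = (1 / (1 - x i) ^ 2 - Q * W) * (1 - x i) ^ 2 := by field_simp
    rw [this, abs_mul, abs_of_pos (show 0 < (1 - x i) ^ 2 by positivity)]
    have := mul_le_mul_of_nonneg_right h3 (show 0 ≤ (1 - x i) ^ 2 by positivity)
    linarith
  set z := Q * W * (1 - x i) ^ 2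
  rw [Real.dist_eq, abs_sub_comm]
  have hη1 : η ≤ ε / 8 := min_le_left _ _
  have hη2 : η ≤ 1 / 8 := min_le_right _ _
  have hz : 0 ≤ z := by positivity
  have h5 := (abs_le.1 h4).1
  have h6 : z ≤ 2 := by nlinarith
  have h7 : 2 * η * z ≤ 2 * (ε / 8) * 2 := by gcongr
  linarith

lemma tendsto_mul_one_sub_exp (lam : ℝ) :
    Tendsto (fun m : ℕ => (m:ℝ) * (1 - Real.exp (-(lam / m)))) atTop (𝓝 lam) := by
  have hd : HasDerivAt (fun y : ℝ => 1 - Real.exp (-(lam * y))) lam 0 := by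
    have h1 : HasDerivAt (fun y : ℝ => -(lam * y)) (-lam) 0 := by
      simpa [neg_mul] using ((hasDerivAt_id (0:ℝ)).const_mul (-lam))
    simpa using (h1.exp).const_sub 1
  have hs := hasDerivAt_iff_tendsto_slope.1 hd
  have hm : Tendsto (fun m : ℕ => ((m:ℝ))⁻¹) atTop (𝓝[≠] 0) := by
    refine tendsto_nhdsWithin_iff.2 ⟨tendsto_inv_atTop_nhds_zero_nat, ?_⟩
    filter_upwards [eventually_ge_atTop 1] with m hm
    have : (0:ℝ) < m := by exact_mod_cast hm
    exact (inv_pos.2 this).ne'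
  refine (hs.comp hm).congr' ?_
  filter_upwards [eventually_ge_atTop 1] with m hm
  have : (0:ℝ) < m := by exact_mod_cast hm
  simp only [Function.comp, slope_def_field]
  simp only [mul_zero, neg_zero, Real.exp_zero, sub_self, sub_zero, div_eq_mul_inv]
  rw [mul_comm, inv_inv]

lemma renewal_tauber {ι : Type*} {l : Filter ι} {q p : ι → ℕ → ℝ} {r : ι → ℕ → ℕ → ℝ}
    {b w : ℕ → ℝ} (h0 : ∀ n, 0 ≤ b n) (hb : Antitone b) (hb0 : 0 < b 0)
    (hw : ∀ n, w n = ∑ k ∈ Finset.range n, b k) {α : ℝ} (hα0 : 0 < α) (hα1 : α < 1)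
    (hr : ∀ t : ℝ, 0 < t → Tendsto (fun n : ℕ => w ⌊t * n⌋₊ / w n) atTop (𝓝 (t ^ (1 - α))))
    (hd : ∀ i, RenewalData (q i) (p i) (r i)) {C : ℝ} {K N0 : ℕ} (hC : 0 ≤ C)
    (hsw : ∀ N, N0 ≤ N → ∀ i a, p i a ≤
      C * ∑ t ∈ Finset.range (K + 1), (∑ k ∈ Finset.range N, r i k (a + t)) / w N)
    (hap : ∀ ε : ℝ, 0 < ε → ∃ N1, ∀ N, N1 ≤ N → ∀ i j,
      |(∑ k ∈ Finset.range N, r i k j) / w N - q i j| ≤ ε * p i j)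
    {m : ι → ℕ} (hm1 : ∀ i, 1 ≤ m i) (hm : Tendsto m l atTop) :
    Tendsto (fun i => w (m i) / m i * ∑ j ∈ Finset.range (m i + 1), q i j) l
      (𝓝 (1 / Real.Gamma (2 - α) / Real.Gamma (α + 1))) := by
  have hwm := w_mono h0 hw
  have hw1 := w_pos h0 hb0 hw le_rfl
  have hΓ : 0 < Real.Gamma (2 - α) := Real.Gamma_pos_of_pos (by linarith)
  have hmp : ∀ i, (0:ℝ) < m i := fun i => by exact_mod_cast hm1 i
  have hws : ∀ y : ℝ, 0 < y → y < 1 → Summable fun N => y ^ N * w (N + 1) := by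
    intro y hy0 hy1
    have hg := summable_geometric_of_lt_one hy0.le hy1
    have hk := (hasSum_coe_mul_geometric_of_norm_lt_one (𝕜 := ℝ) (r := y)
      (by rwa [Real.norm_of_nonneg hy0.le])).summable
    refine Summable.of_nonneg_of_le
      (fun N => mul_nonneg (by positivity) (w_pos h0 hb0 hw (by omega)).le) (fun N => ?_)
      ((hk.add hg).mul_right (w 1))
    have := w_conc hb hw (show 1 ≤ N + 1 by omega)
    push_cast at this
    have h2 := mul_le_mul_of_nonneg_left this (show 0 ≤ y ^ N by positivity)
    linarith
  refine karamata hα0 (by positivity) (fun i => (hd i).q0) hm1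
    (fun i => div_nonneg (w_pos h0 hb0 hw (hm1 i)).le (hmp i).le)
    (fun i x h1 h2 => (hd i).sumq h1 h2) fun k => ?_
  set lam : ℝ := (k:ℝ) + 1 with hlam
  have hlp : 0 < lam := by positivity
  set x : ι → ℝ := fun i => Real.exp (-(lam / m i)) with hx
  have hx0 : ∀ i, 0 < x i := fun i => Real.exp_pos _
  have hx1 : ∀ i, x i < 1 := fun i => by
    have := hmp i
    simp only [hx]
    rw [Real.exp_lt_one_iff, neg_lt_zero]; positivity
  have hxl : Tendsto x l (𝓝 1) := by
    have h1 : Tendsto (fun i => -(lam / (m i : ℝ))) l (𝓝 0) := by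
      have := ((tendsto_const_nhds (x := lam)).div_atTop (tendsto_natCast_atTop_atTop (R := ℝ))).comp hm
      simpa [Function.comp_def] using this.neg
    simpa using h1.rexp
  have hren := renewal_laplace hwm hw1 hd hC hsw hap hx0 hx1 hxl hws
  have hW := (laplace_w h0 hb hb0 hw (show 0 < 1 - α by linarith) hr lam hlp).comp hm
  have hone := (tendsto_mul_one_sub_exp lam).comp hm
  have hlim := (hren.mul hxl).div (hW.mul (hone.pow 2)) (by positivity)
  have hval : 1 * 1 / ((1 / lam) ^ (1 - α + 1) * Real.Gamma (1 - α + 1) * lam ^ 2) =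
      1 / Real.Gamma (2 - α) * (1 / lam) ^ α := by
    have e : (1:ℝ) - α + 1 = 2 - α := by ring
    rw [e, Real.rpow_sub (by positivity)]
    have : 0 < (1 / lam) ^ α := by positivity
    have h2 : (1 / lam) ^ (2:ℝ) = 1 / lam ^ 2 := by
      rw [Real.rpow_two, one_div_pow]
    rw [h2]
    field_simp
  rw [hval] at hlim
  refine hlim.congr fun i => ?_
  simp only [Function.comp, Pi.div_apply]
  have hxi := hx0 i
  have hWx : ∑' N, x i ^ N * w N = x i * ∑' N, x i ^ N * w (N + 1) := by
    have hs : Summable fun N => x i ^ N * w N := by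
      rw [← summable_nat_add_iff 1]
      refine ((hws (x i) (hx0 i) (hx1 i)).mul_left (x i)).congr fun N => ?_
      rw [pow_succ]; ring
    rw [hs.tsum_eq_zero_add, w_zero hw, mul_zero, zero_add, ← tsum_mul_left]
    congr 1; ext N; rw [pow_succ]; ring
  have hWp : 0 < ∑' N, x i ^ N * w (N + 1) := by
    refine (hws (x i) (hx0 i) (hx1 i)).tsum_pos
      (fun N => mul_nonneg (by positivity) (w_pos h0 hb0 hw (by omega)).le) 0 ?_
    simpa using hw1
  have h1x : 0 < 1 - x i := by linarith [hx1 i]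
  have hwmi := w_pos h0 hb0 hw (hm1 i)
  have := hmp i
  change _ * x i / ((∑' N, x i ^ N * w N) / _ * ((m i : ℝ) * (1 - x i)) ^ 2) = _
  rw [hWx]
  field_simp
  rfl

section dyn
variable {X : Type*} [MeasurableSpace X] {μ : Measure X} {T : X → X} {Y : Set X}

lemma lt_firstReturn_iff {X : Type*} {T : X → X} {Y : Set X} {x : X} {k : ℕ} :
    (k : ℕ∞) < firstReturn T Y x ↔ ∀ i, 1 ≤ i → i ≤ k → T^[i] x ∉ Y := by
  rw [← not_le, not_iff_comm]
  unfold firstReturn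
  push Not
  constructor
  · rintro ⟨i, h1, h2, h3⟩
    exact (iInf₂_le i ⟨h1, h3⟩).trans (by exact_mod_cast h2)
  · intro h
    by_contra hcon
    push Not at hcon
    have : ((k + 1 : ℕ) : ℕ∞) ≤ ⨅ (k : ℕ) (_ : 1 ≤ k ∧ T^[k] x ∈ Y), (k : ℕ∞) := by
      refine le_iInf₂ fun i hi => ?_
      have : k < i := by
        by_contra hk
        exact hcon i hi.1 (by omega) hi.2
      exact_mod_cast this
    have := this.trans h
    have : k + 1 ≤ k := by exact_mod_cast this
    omega

lemma firstReturn_eq_iff {X : Type*} {T : X → X} {Y : Set X} {x : X} {k : ℕ} :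
    firstReturn T Y x = ((k + 1 : ℕ) : ℕ∞) ↔ T^[k + 1] x ∈ Y ∧ ∀ i, 1 ≤ i → i ≤ k → T^[i] x ∉ Y := by
  have h1 : firstReturn T Y x = ((k + 1 : ℕ) : ℕ∞) ↔
      (k : ℕ∞) < firstReturn T Y x ∧ ¬ (((k + 1 : ℕ) : ℕ∞) < firstReturn T Y x) := by
    rw [not_lt]
    constructor
    · intro h; rw [h]; exact ⟨by exact_mod_cast Nat.lt_succ_self k, le_rfl⟩
    · rintro ⟨h1, h2⟩
      refine le_antisymm h2 ?_
      have := Order.add_one_le_of_lt h1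
      exact_mod_cast this
  rw [h1, lt_firstReturn_iff, lt_firstReturn_iff]
  push Not
  constructor
  · rintro ⟨h2, i, h3, h4, h5⟩
    refine ⟨?_, h2⟩
    rcases Nat.lt_or_ge k i with h | h
    · have : i = k + 1 := by omega
      exact this ▸ h5
    · exact absurd h5 (h2 i h3 h)
  · rintro ⟨h2, h3⟩
    exact ⟨h3, k + 1, by omega, le_rfl, h2⟩

lemma mem_Ypart_iff {X : Type*} {T : X → X} {Y : Set X} {x : X} {k : ℕ} :
    x ∈ Ypart T Y k ↔ T^[k] x ∈ Y ∧ ∀ i < k, T^[i] x ∉ Y := by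
  cases k with
  | zero => simp [Ypart]
  | succ n =>
    simp only [Ypart, mem_inter_iff, mem_compl_iff, mem_setOf_eq]
    rw [firstReturn_eq_iff]
    constructor
    · rintro ⟨h1, h2, h3⟩
      refine ⟨h2, fun i hi => ?_⟩
      rcases Nat.eq_zero_or_pos i with rfl | h
      · exact h1
      · exact h3 i h (by omega)
    · rintro ⟨h1, h2⟩
      exact ⟨h2 0 (by omega), h1, fun i _ hi => h2 i (by omega)⟩

/-- excursion sets `Y ∩ {φ > k}` -/
def exc {X : Type*} (T : X → X) (Y : Set X) (k : ℕ) : Set X := Y ∩ {x | (k : ℕ∞) < firstReturn T Y x}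

lemma meas_exc (hT : Measurable T) (hY : MeasurableSet Y) (k : ℕ) : MeasurableSet (exc T Y k) := by
  refine hY.inter ?_
  have : {x | (k : ℕ∞) < firstReturn T Y x} = ⋂ i ∈ {i | 1 ≤ i ∧ i ≤ k}, (T^[i] ⁻¹' Y)ᶜ := by
    ext x
    simp [lt_firstReturn_iff]
  rw [this]
  exact MeasurableSet.biInter (Set.to_countable _) fun i _ => ((hT.iterate i) hY).compl

lemma meas_Ypart (hT : Measurable T) (hY : MeasurableSet Y) (k : ℕ) : MeasurableSet (Ypart T Y k) := by
  have : Ypart T Y k = (T^[k] ⁻¹' Y) ∩ ⋂ i ∈ {i | i < k}, (T^[i] ⁻¹' Y)ᶜ := by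
    ext x
    simp [mem_Ypart_iff]
  rw [this]
  exact ((hT.iterate k) hY).inter
    (MeasurableSet.biInter (Set.to_countable _) fun i _ => ((hT.iterate i) hY).compl)

lemma exc_anti {X : Type*} {T : X → X} {Y : Set X} {a b : ℕ} (h : a ≤ b) : exc T Y b ⊆ exc T Y a := by
  intro x hx
  exact ⟨hx.1, show (a:ℕ∞) < firstReturn T Y x from
    lt_of_le_of_lt (by exact_mod_cast h) (show (b:ℕ∞) < firstReturn T Y x from hx.2)⟩

lemma renewal_eq (hT : MeasurePreserving T μ μ) (hY : MeasurableSet Y) {A : Set X} (hA : MeasurableSet A)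
    (hAY : A ⊆ Y) (s : ℕ) :
    ∑ a ∈ Finset.HasAntidiagonal.antidiagonal s, μ (Ypart T Y a.1 ∩ T^[a.1 + a.2] ⁻¹' A) = μ A := by
  have hTm := hT.measurable
  have e1 : ∑ a ∈ Finset.HasAntidiagonal.antidiagonal s, μ (Ypart T Y a.1 ∩ T^[a.1 + a.2] ⁻¹' A) =
      ∑ k ∈ Finset.range (s + 1), μ (Ypart T Y k ∩ T^[s] ⁻¹' A) := by
    rw [Finset.Nat.sum_antidiagonal_eq_sum_range_succ_mk]
    refine Finset.sum_congr rfl fun k hk => ?_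
    have : k ≤ s := by simp at hk; omega
    simp only
    rw [Nat.add_sub_cancel' this]
  rw [e1, ← measure_biUnion_finset, ← (hT.iterate s).measure_preimage hA.nullMeasurableSet]
  · congr 1
    ext x
    simp only [mem_iUnion, mem_inter_iff, mem_preimage, exists_prop, Finset.mem_range]
    constructor
    · rintro ⟨k, _, _, h⟩; exact h
    · intro h
      have hex : ∃ k, T^[k] x ∈ Y := ⟨s, hAY h⟩
      classical
      refine ⟨Nat.find hex, Nat.lt_succ_of_le (Nat.find_min' hex (hAY h)), ?_, h⟩
      rw [mem_Ypart_iff]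
      exact ⟨Nat.find_spec hex, fun i hi => Nat.find_min hex hi⟩
  · intro i _ j _ hij
    rw [Function.onFun, Set.disjoint_left]
    rintro x ⟨hi, _⟩ ⟨hj, _⟩
    rw [mem_Ypart_iff] at hi hj
    rcases lt_or_gt_of_ne hij with h | h
    · exact hj.2 i h hi.1
    · exact hi.2 j h hj.1
  · intro k _
    exact (meas_Ypart hTm hY k).inter ((hTm.iterate s) hA)

variable {hatT : (X → ℝ≥0∞) → (X → ℝ≥0∞)}

lemma hatT_iter_meas (hatTmeas : ∀ u, Measurable u → Measurable (hatT u)) (k : ℕ) :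
    ∀ u, Measurable u → Measurable (hatT^[k] u) := by
  induction k with
  | zero => intro u hu; simpa using hu
  | succ n ih => intro u hu; rw [Function.iterate_succ_apply]; exact ih _ (hatTmeas u hu)

lemma hatT_iter_dual (hT : Measurable T) (hatTmeas : ∀ u, Measurable u → Measurable (hatT u))
    (hatTdual : ∀ u v : X → ℝ≥0∞, Measurable u → Measurable v →
      ∫⁻ x, v (T x) * u x ∂μ = ∫⁻ x, v x * hatT u x ∂μ) (k : ℕ) :
    ∀ u v : X → ℝ≥0∞, Measurable u → Measurable v →
      ∫⁻ x, v (T^[k] x) * u x ∂μ = ∫⁻ x, v x * (hatT^[k] u) x ∂μ := by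
  induction k with
  | zero => intro u v _ _; simp
  | succ n ih =>
    intro u v hu hv
    rw [Function.iterate_succ_apply, ← ih _ v (hatTmeas u hu) hv,
      ← hatTdual u (fun x => v (T^[n] x)) hu (hv.comp (hT.iterate n))]
    simp only [Function.iterate_succ_apply]

lemma hatT_set_dual (hT : Measurable T) (hatTmeas : ∀ u, Measurable u → Measurable (hatT u))
    (hatTdual : ∀ u v : X → ℝ≥0∞, Measurable u → Measurable v →
      ∫⁻ x, v (T x) * u x ∂μ = ∫⁻ x, v x * hatT u x ∂μ) (k j : ℕ) {A : Set X} (hA : MeasurableSet A)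
    {u : X → ℝ≥0∞} (hu : Measurable u) :
    ∫⁻ x in T^[j] ⁻¹' A, (hatT^[k] u) x ∂μ = ∫⁻ x in T^[k + j] ⁻¹' A, u x ∂μ := by
  have hconv : ∀ (B : Set X) (hB : MeasurableSet B) (f : X → ℝ≥0∞),
      ∫⁻ x in B, f x ∂μ = ∫⁻ x, B.indicator (fun _ => 1) x * f x ∂μ := by
    intro B hB f
    rw [← lintegral_indicator hB]
    congr 1; ext x
    by_cases h : x ∈ B <;> simp [h]
  rw [hconv _ ((hT.iterate _) hA), hconv _ ((hT.iterate _) hA),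
    ← hatT_iter_dual hT hatTmeas hatTdual k u _ hu (measurable_const.indicator ((hT.iterate j) hA))]
  congr 1; ext x
  congr 1
  have hiff : T^[k] x ∈ T^[j] ⁻¹' A ↔ x ∈ T^[k + j] ⁻¹' A := by
    rw [mem_preimage, mem_preimage, add_comm k j, Function.iterate_add_apply]
  by_cases h : x ∈ T^[k + j] ⁻¹' A
  · rw [indicator_of_mem h, indicator_of_mem (hiff.2 h)]
  · rw [indicator_of_notMem h, indicator_of_notMem (fun h' => h (hiff.1 h'))]

lemma meas_entrance (hT : Measurable T) (hY : MeasurableSet Y)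
    (hatTmeas : ∀ u, Measurable u → Measurable (hatT u)) (n : ℕ) :
    Measurable (entrance T Y μ hatT n) := by
  unfold entrance
  refine Measurable.div_const (Finset.measurable_fun_sum _ fun k _ => ?_) _
  exact hatT_iter_meas hatTmeas k _ (measurable_const.indicator (meas_Ypart hT hY k))

lemma entrance_int (hT : Measurable T) (hY : MeasurableSet Y)
    (hatTmeas : ∀ u, Measurable u → Measurable (hatT u))
    (hatTdual : ∀ u v : X → ℝ≥0∞, Measurable u → Measurable v →
      ∫⁻ x, v (T x) * u x ∂μ = ∫⁻ x, v x * hatT u x ∂μ) (n j : ℕ) {A : Set X} (hA : MeasurableSet A) :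
    ∫⁻ x in T^[j] ⁻¹' A, entrance T Y μ hatT n x ∂μ =
      (∑ k ∈ Finset.range n, μ (Ypart T Y k ∩ T^[k + j] ⁻¹' A)) / wrate T Y μ n := by
  unfold entrance
  simp_rw [div_eq_mul_inv]
  have hm : ∀ k, Measurable (hatT^[k] ((Ypart T Y k).indicator fun _ => (1:ℝ≥0∞))) := fun k =>
    hatT_iter_meas hatTmeas k _ (measurable_const.indicator (meas_Ypart hT hY k))
  rw [lintegral_mul_const _ (Finset.measurable_fun_sum _ fun k _ => hm k),
    lintegral_finsetSum _ (fun k _ => hm k)]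
  congr 1
  refine Finset.sum_congr rfl fun k _ => ?_
  rw [hatT_set_dual hT hatTmeas hatTdual k j hA (measurable_const.indicator (meas_Ypart hT hY k)),
    lintegral_indicator (meas_Ypart hT hY k), Measure.restrict_restrict (meas_Ypart hT hY k)]
  simp

lemma entrance_off (hT : Measurable T) (hY : MeasurableSet Y)
    (hatTmeas : ∀ u, Measurable u → Measurable (hatT u))
    (hatTdual : ∀ u v : X → ℝ≥0∞, Measurable u → Measurable v →
      ∫⁻ x, v (T x) * u x ∂μ = ∫⁻ x, v x * hatT u x ∂μ) (n : ℕ) :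
    ∀ᵐ x ∂μ, x ∉ Y → entrance T Y μ hatT n x = 0 := by
  have h := entrance_int (μ := μ) hT hY hatTmeas hatTdual n 0 hY.compl
  have h2 : ∀ k, Ypart T Y k ∩ T^[k + 0] ⁻¹' Yᶜ = ∅ := by
    intro k
    ext x
    simp only [add_zero, mem_inter_iff, mem_preimage, mem_compl_iff, mem_empty_iff_false, iff_false, not_and,
      not_not]
    intro hx
    exact (mem_Ypart_iff.1 hx).1
  simp only [h2, measure_empty, Finset.sum_const_zero, ENNReal.zero_div] at h
  rw [lintegral_eq_zero_iff (meas_entrance hT hY hatTmeas n)] at h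
  have := (ae_restrict_iff' (by simpa using hY.compl)).1 h
  filter_upwards [this] with x hx hxY
  exact hx hxY

lemma H_off (hT : Measurable T) (hY : MeasurableSet Y)
    (hatTmeas : ∀ u, Measurable u → Measurable (hatT u))
    (hatTdual : ∀ u v : X → ℝ≥0∞, Measurable u → Measurable v →
      ∫⁻ x, v (T x) * u x ∂μ = ∫⁻ x, v x * hatT u x ∂μ)
    {H : X → ℝ≥0∞}
    (hA4 : ∀ ε : ℝ≥0∞, 0 < ε → ∀ᶠ n : ℕ in atTop, ∀ᵐ x ∂μ,
      entrance T Y μ hatT n x ≤ H x + ε ∧ H x ≤ entrance T Y μ hatT n x + ε) :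
    ∀ᵐ x ∂μ, x ∉ Y → H x = 0 := by
  have h1 : ∀ i : ℕ, ∀ᵐ x ∂μ, x ∉ Y → H x ≤ ((i:ℝ≥0∞) + 1)⁻¹ := by
    intro i
    obtain ⟨n, hn⟩ := (hA4 (((i:ℝ≥0∞) + 1)⁻¹) (by simp)).exists
    filter_upwards [hn, entrance_off hT hY hatTmeas hatTdual n] with x h2 h3 h4
    have := h2.2
    rwa [h3 h4, zero_add] at this
  filter_upwards [ae_all_iff.2 h1] with x hx hxY
  by_contra hne
  obtain ⟨i, hi⟩ := ENNReal.exists_inv_nat_lt hne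
  have h5 := hx i hxY
  have : ((i:ℝ≥0∞) + 1)⁻¹ ≤ (i:ℝ≥0∞)⁻¹ := ENNReal.inv_le_inv.2 le_self_add
  exact absurd (h5.trans this) (not_le.2 hi)

lemma approx_int (hT : Measurable T) (hY : MeasurableSet Y)
    (hatTmeas : ∀ u, Measurable u → Measurable (hatT u))
    (hatTdual : ∀ u v : X → ℝ≥0∞, Measurable u → Measurable v →
      ∫⁻ x, v (T x) * u x ∂μ = ∫⁻ x, v x * hatT u x ∂μ)
    {H : X → ℝ≥0∞}
    (hA4 : ∀ ε : ℝ≥0∞, 0 < ε → ∀ᶠ n : ℕ in atTop, ∀ᵐ x ∂μ,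
      entrance T Y μ hatT n x ≤ H x + ε ∧ H x ≤ entrance T Y μ hatT n x + ε) (ε : ℝ≥0∞) (hε : 0 < ε) :
    ∀ᶠ n : ℕ in atTop, ∀ B : Set X, MeasurableSet B →
      ∫⁻ x in B, entrance T Y μ hatT n x ∂μ ≤ ∫⁻ x in B, H x ∂μ + ε * μ (Y ∩ B) ∧
      ∫⁻ x in B, H x ∂μ ≤ ∫⁻ x in B, entrance T Y μ hatT n x ∂μ + ε * μ (Y ∩ B) := by
  have hH0 := H_off hT hY hatTmeas hatTdual hA4
  filter_upwards [hA4 ε hε] with n hn B hB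
  have hi : ∫⁻ x in B, Y.indicator (fun _ => ε) x ∂μ = ε * μ (Y ∩ B) := by
    rw [lintegral_indicator hY, Measure.restrict_restrict hY]; simp
  have hmi : Measurable (Y.indicator (fun _ => ε)) := measurable_const.indicator hY
  have hae : ∀ᵐ x ∂μ, entrance T Y μ hatT n x ≤ H x + Y.indicator (fun _ => ε) x ∧
      H x ≤ entrance T Y μ hatT n x + Y.indicator (fun _ => ε) x := by
    filter_upwards [hn, hH0, entrance_off hT hY hatTmeas hatTdual n] with x h1 h2 h3
    by_cases hx : x ∈ Y
    · simpa [hx] using h1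
    · simp [h2 hx, h3 hx]
  rw [← hi, ← lintegral_add_right _ hmi, ← lintegral_add_right _ hmi]
  exact ⟨lintegral_mono_ae (ae_restrict_of_ae (hae.mono fun x h => h.1)),
    lintegral_mono_ae (ae_restrict_of_ae (hae.mono fun x h => h.2))⟩

lemma sweep_int (hT : Measurable T) (hY : MeasurableSet Y)
    (hatTmeas : ∀ u, Measurable u → Measurable (hatT u))
    (hatTdual : ∀ u v : X → ℝ≥0∞, Measurable u → Measurable v →
      ∫⁻ x, v (T x) * u x ∂μ = ∫⁻ x, v x * hatT u x ∂μ) {C : ℝ≥0∞} {K n : ℕ}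
    (hA3 : ∀ᵐ x ∂μ.restrict Y,
        1 ≤ C * ∑ j ∈ Finset.range (K + 1), (hatT^[j] (entrance T Y μ hatT n)) x)
    {A : Set X} (hA : MeasurableSet A) (i : ℕ) :
    μ (Y ∩ T^[i] ⁻¹' A) ≤ C * ∑ t ∈ Finset.range (K + 1),
      (∑ k ∈ Finset.range n, μ (Ypart T Y k ∩ T^[k + (i + t)] ⁻¹' A)) / wrate T Y μ n := by
  have hB : MeasurableSet (T^[i] ⁻¹' A) := (hT.iterate i) hA
  have hme := meas_entrance (μ := μ) hT hY hatTmeas n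
  have hm : ∀ k, Measurable (hatT^[k] (entrance T Y μ hatT n)) := fun k => hatT_iter_meas hatTmeas k _ hme
  have h1 : μ (Y ∩ T^[i] ⁻¹' A) = ∫⁻ x in T^[i] ⁻¹' A, Y.indicator (fun _ => 1) x ∂μ := by
    rw [lintegral_indicator hY, Measure.restrict_restrict hY]; simp
  rw [h1]
  have h2 : ∫⁻ x in T^[i] ⁻¹' A, Y.indicator (fun _ => 1) x ∂μ ≤
      ∫⁻ x in T^[i] ⁻¹' A, C * ∑ j ∈ Finset.range (K + 1), (hatT^[j] (entrance T Y μ hatT n)) x ∂μ := by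
    refine lintegral_mono_ae (ae_restrict_of_ae ?_)
    filter_upwards [(ae_restrict_iff' hY).1 hA3] with x hx
    by_cases h : x ∈ Y
    · simpa [h] using hx h
    · simp [h]
  refine h2.trans (le_of_eq ?_)
  rw [lintegral_const_mul _ (Finset.measurable_fun_sum _ fun k _ => hm k), lintegral_finsetSum _ (fun k _ => hm k)]
  congr 1
  refine Finset.sum_congr rfl fun t _ => ?_
  rw [hatT_set_dual hT hatTmeas hatTdual t i hA hme, entrance_int hT hY hatTmeas hatTdual n (t + i) hA, add_comm t i]

lemma lastVisit_decomp {X : Type*} {T : X → X} {Y : Set X} {n m : ℕ} (hmn : m ≤ n) :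
    Y ∩ {x | lastVisit T Y n x ≤ m} = ⋃ j ∈ Finset.range (m + 1), (Y ∩ T^[j] ⁻¹' exc T Y (n - j)) := by
  ext x
  simp only [mem_inter_iff, mem_setOf_eq, mem_iUnion, Finset.mem_range, exists_prop, mem_preimage, exc]
  have hbdd : BddAbove {k | k ≤ n ∧ T^[k] x ∈ Y} := ⟨n, fun k hk => hk.1⟩
  constructor
  · rintro ⟨hx, hl⟩
    have hne : {k | k ≤ n ∧ T^[k] x ∈ Y}.Nonempty := ⟨0, by simp, by simpa using hx⟩
    have hmem := Nat.sSup_mem hne hbdd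
    refine ⟨lastVisit T Y n x, by omega, hx, hmem.2, ?_⟩
    rw [lt_firstReturn_iff]
    intro i hi1 hi2 hi3
    rw [← Function.iterate_add_apply] at hi3
    have h1 : i + lastVisit T Y n x ≤ lastVisit T Y n x :=
      le_csSup hbdd ⟨by have := hmem.1; change lastVisit T Y n x ≤ n at this; omega, hi3⟩
    omega
  · rintro ⟨j, hj, hx, hjY, hφ⟩
    refine ⟨hx, ?_⟩
    rw [lt_firstReturn_iff] at hφ
    have hne : {k | k ≤ n ∧ T^[k] x ∈ Y}.Nonempty := ⟨0, by simp, by simpa using hx⟩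
    have : lastVisit T Y n x ≤ j := by
      refine csSup_le hne fun k hk => ?_
      by_contra hkj
      push Not at hkj
      refine hφ (k - j) (by omega) (by have := hk.1; omega) ?_
      rw [← Function.iterate_add_apply, Nat.sub_add_cancel hkj.le]
      exact hk.2
    omega

lemma lastVisit_int {H : X → ℝ≥0∞} (hT : Measurable T) (hY : MeasurableSet Y) (hH : ∀ᵐ x ∂μ, x ∉ Y → H x = 0)
    {n m : ℕ} (hmn : m ≤ n) :
    ∫⁻ x in {x | lastVisit T Y n x ≤ m}, H x ∂μ =
      ∑ j ∈ Finset.range (m + 1), ∫⁻ x in T^[j] ⁻¹' exc T Y (n - j), H x ∂μ := by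
  have hind : ∀ S : Set X, ∫⁻ x in S, H x ∂μ = ∫⁻ x in Y ∩ S, H x ∂μ := by
    intro S
    have : ∫⁻ x in S, H x ∂μ = ∫⁻ x in S, Y.indicator H x ∂μ := by
      refine lintegral_congr_ae (ae_restrict_of_ae ?_)
      filter_upwards [hH] with x hx
      by_cases h : x ∈ Y <;> simp [h, hx]
    rw [this, lintegral_indicator hY, Measure.restrict_restrict hY]
  rw [hind, lastVisit_decomp hmn, lintegral_biUnion_finset]
  · exact Finset.sum_congr rfl fun j _ => (hind _).symm
  · intro i hi j hj hij
    have hi' : i < m + 1 := by simpa using hi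
    have hj' : j < m + 1 := by simpa using hj
    rw [Function.onFun, Set.disjoint_left]
    have key : ∀ a b : ℕ, a < b → b < m + 1 → ∀ x, x ∈ T^[a] ⁻¹' exc T Y (n - a) → x ∉ T^[b] ⁻¹' exc T Y (n - b) := by
      intro a b hab hb x h1 h2
      have h3 := (lt_firstReturn_iff.1 h1.2) (b - a) (by omega) (by omega)
      rw [← Function.iterate_add_apply, Nat.sub_add_cancel hab.le] at h3
      exact h3 h2.1
    rintro x ⟨_, h1⟩ ⟨_, h2⟩
    rcases lt_or_gt_of_ne hij with h | h
    · exact key i j h hj' x h1 h2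
    · exact key j i h hi' x h2 h1
  · intro j _
    exact hY.inter ((hT.iterate j) (meas_exc hT hY _))

end dyn

section fin
variable {X : Type*} [MeasurableSpace X] {μ : Measure X} {T : X → X} {Y : Set X}
variable {hatT : (X → ℝ≥0∞) → (X → ℝ≥0∞)}

lemma exc_lt_top (hY1 : μ Y < ⊤) (k : ℕ) : μ (exc T Y k) < ⊤ :=
  (measure_mono Set.inter_subset_left).trans_lt hY1

lemma wrate_toReal (hY1 : μ Y < ⊤) (n : ℕ) :
    (wrate T Y μ n).toReal = ∑ k ∈ Finset.range n, (μ (exc T Y k)).toReal := by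
  unfold wrate
  rw [ENNReal.toReal_sum]
  · rfl
  · exact fun k _ => (exc_lt_top hY1 k).ne

lemma exc_zero : exc T Y 0 = Y := by
  ext x
  constructor
  · exact fun h => h.1
  · intro h
    refine ⟨h, ?_⟩
    change ((0:ℕ):ℕ∞) < firstReturn T Y x
    rw [lt_firstReturn_iff]
    intro i h1 h2
    omega

lemma H_int_lt_top (hY1 : μ Y < ⊤) (hY : MeasurableSet Y) {H : X → ℝ≥0∞}
    (hHbd : ∃ M : ℝ≥0∞, M ≠ ⊤ ∧ ∀ᵐ x ∂μ, H x ≤ M)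
    (hH : ∀ᵐ x ∂μ, x ∉ Y → H x = 0) : ∫⁻ x, H x ∂μ < ⊤ := by
  obtain ⟨M, hM, hb⟩ := hHbd
  calc ∫⁻ x, H x ∂μ ≤ ∫⁻ x, Y.indicator (fun _ => M) x ∂μ := by
        refine lintegral_mono_ae ?_
        filter_upwards [hb, hH] with x h1 h2
        by_cases hx : x ∈ Y
        · simpa [hx] using h1
        · simp [hx, h2 hx]
    _ = M * μ Y := by rw [lintegral_indicator hY]; simp
    _ < ⊤ := ENNReal.mul_lt_top hM.lt_top hY1

/-- real-valued renewal data attached to a set `A` -/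
noncomputable def qA (μ : Measure X) (T : X → X) (H : X → ℝ≥0∞) (A : Set X) (j : ℕ) : ℝ :=
  (∫⁻ x in T^[j] ⁻¹' A, H x ∂μ).toReal / (μ A).toReal
noncomputable def pA (μ : Measure X) (T : X → X) (Y A : Set X) (j : ℕ) : ℝ :=
  (μ (Y ∩ T^[j] ⁻¹' A)).toReal / (μ A).toReal
noncomputable def rA (μ : Measure X) (T : X → X) (Y A : Set X) (k j : ℕ) : ℝ :=
  (μ (Ypart T Y k ∩ T^[k + j] ⁻¹' A)).toReal / (μ A).toReal

lemma pre_lt_top (hT : MeasurePreserving T μ μ) {A : Set X} (hA : MeasurableSet A) (hA1 : μ A < ⊤)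
    (B : Set X) (j : ℕ) : μ (B ∩ T^[j] ⁻¹' A) ≤ μ A := by
  rw [← (hT.iterate j).measure_preimage hA.nullMeasurableSet]
  exact measure_mono Set.inter_subset_right

lemma renewalData_A (hT : MeasurePreserving T μ μ) (hY : MeasurableSet Y) {H : X → ℝ≥0∞}
    (hHi : ∫⁻ x, H x ∂μ < ⊤)
    {A : Set X} (hA : MeasurableSet A) (hAY : A ⊆ Y) (hA0 : 0 < μ A) (hA1 : μ A < ⊤) :
    RenewalData (qA μ T H A) (pA μ T Y A) (rA μ T Y A) where
  q0 j := by unfold qA; positivity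
  qM := by
    refine ⟨(∫⁻ x, H x ∂μ).toReal / (μ A).toReal, fun j => ?_⟩
    unfold qA
    gcongr
    · exact hHi.ne
    · exact Measure.restrict_le_self
  p0 j := by unfold pA; positivity
  p1 j := by
    unfold pA
    refine div_le_one_of_le₀ ?_ ENNReal.toReal_nonneg
    exact ENNReal.toReal_mono hA1.ne (pre_lt_top hT hA hA1 _ _)
  r0 k j := by unfold rA; positivity
  ren s := by
    unfold rA
    rw [← Finset.sum_div, ← ENNReal.toReal_sum, renewal_eq hT hY hA hAY s]
    · exact div_self (ENNReal.toReal_pos hA0.ne' hA1.ne).ne'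
    · exact fun a _ => ((pre_lt_top hT hA hA1 _ _).trans_lt hA1).ne

lemma sum_rA (hT : MeasurePreserving T μ μ) {A : Set X} (hA : MeasurableSet A) (hA1 : μ A < ⊤)
    (N j : ℕ) :
    (∑ k ∈ Finset.range N, rA μ T Y A k j) / (wrate T Y μ N).toReal =
    ((∑ k ∈ Finset.range N, μ (Ypart T Y k ∩ T^[k + j] ⁻¹' A)) / wrate T Y μ N).toReal
      / (μ A).toReal := by
  unfold rA
  rw [← Finset.sum_div, ENNReal.toReal_div, ENNReal.toReal_sum]
  · ring
  · exact fun a _ => ((pre_lt_top hT hA hA1 _ _).trans_lt hA1).ne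

lemma sum_lt_top (hT : MeasurePreserving T μ μ) {A : Set X} (hA : MeasurableSet A) (hA1 : μ A < ⊤)
    {N : ℕ} (hN : wrate T Y μ N ≠ 0) (j : ℕ) :
    (∑ k ∈ Finset.range N, μ (Ypart T Y k ∩ T^[k + j] ⁻¹' A)) / wrate T Y μ N < ⊤ := by
  refine ENNReal.div_lt_top ?_ hN
  exact (ENNReal.sum_lt_top.2 fun a _ => ((pre_lt_top hT hA hA1 _ _).trans_lt hA1)).ne

lemma wrate_ne_zero (hY0 : 0 < μ Y) {N : ℕ} (hN : 1 ≤ N) : wrate T Y μ N ≠ 0 := by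
  have h : μ (exc T Y 0) ≤ wrate T Y μ N :=
    Finset.single_le_sum (f := fun k => μ (exc T Y k)) (fun _ _ => bot_le)
      (Finset.mem_range.2 hN)
  rw [exc_zero] at h
  exact (hY0.trans_le h).ne'

lemma sweep_A (hT : MeasurePreserving T μ μ) (hY : MeasurableSet Y) (hY0 : 0 < μ Y)
    (hatTmeas : ∀ u, Measurable u → Measurable (hatT u))
    (hatTdual : ∀ u v : X → ℝ≥0∞, Measurable u → Measurable v →
      ∫⁻ x, v (T x) * u x ∂μ = ∫⁻ x, v x * hatT u x ∂μ) {C : ℝ≥0∞} {K N : ℕ} (hC : C ≠ ⊤)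
    (hN : 1 ≤ N)
    (hA3 : ∀ᵐ x ∂μ.restrict Y,
        1 ≤ C * ∑ j ∈ Finset.range (K + 1), (hatT^[j] (entrance T Y μ hatT N)) x)
    {A : Set X} (hA : MeasurableSet A) (hA1 : μ A < ⊤) (a : ℕ) :
    pA μ T Y A a ≤ C.toReal * ∑ t ∈ Finset.range (K + 1),
      (∑ k ∈ Finset.range N, rA μ T Y A k (a + t)) / (wrate T Y μ N).toReal := by
  have h := sweep_int hT.measurable hY hatTmeas hatTdual hA3 hA a
  have hfin : ∀ t, (∑ k ∈ Finset.range N, μ (Ypart T Y k ∩ T^[k + (a + t)] ⁻¹' A)) / wrate T Y μ N < ⊤ :=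
    fun t => sum_lt_top hT hA hA1 (wrate_ne_zero hY0 hN) _
  have h2 := ENNReal.toReal_mono
    (ENNReal.mul_lt_top hC.lt_top (ENNReal.sum_lt_top.2 fun t _ => hfin t)).ne h
  rw [ENNReal.toReal_mul, ENNReal.toReal_sum fun t _ => (hfin t).ne] at h2
  simp_rw [sum_rA hT hA hA1]
  rw [← Finset.sum_div, ← mul_div_assoc]
  unfold pA
  gcongr

lemma approx_A (hT : MeasurePreserving T μ μ) (hY : MeasurableSet Y) (hY0 : 0 < μ Y)
    (hatTmeas : ∀ u, Measurable u → Measurable (hatT u))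
    (hatTdual : ∀ u v : X → ℝ≥0∞, Measurable u → Measurable v →
      ∫⁻ x, v (T x) * u x ∂μ = ∫⁻ x, v x * hatT u x ∂μ)
    {H : X → ℝ≥0∞} (hHi : ∫⁻ x, H x ∂μ < ⊤)
    (hA4 : ∀ ε : ℝ≥0∞, 0 < ε → ∀ᶠ n : ℕ in atTop, ∀ᵐ x ∂μ,
      entrance T Y μ hatT n x ≤ H x + ε ∧ H x ≤ entrance T Y μ hatT n x + ε)
    (ε : ℝ) (hε : 0 < ε) :
    ∃ N1, ∀ N, N1 ≤ N → ∀ A : Set X, MeasurableSet A → μ A < ⊤ → ∀ j,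
      |(∑ k ∈ Finset.range N, rA μ T Y A k j) / (wrate T Y μ N).toReal - qA μ T H A j|
        ≤ ε * pA μ T Y A j := by
  obtain ⟨N1, h1⟩ := eventually_atTop.1
    (approx_int hT.measurable hY hatTmeas hatTdual hA4 (ENNReal.ofReal ε) (by simpa using hε))
  refine ⟨max N1 1, fun N hN A hA hA1 j => ?_⟩
  obtain ⟨u1, u2⟩ := h1 N ((le_max_left _ _).trans hN) (T^[j] ⁻¹' A) ((hT.measurable.iterate j) hA)
  rw [entrance_int hT.measurable hY hatTmeas hatTdual N j hA] at u1 u2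
  rw [sum_rA hT hA hA1]
  have hE := sum_lt_top (Y := Y) hT hA hA1 (wrate_ne_zero (T := T) hY0 ((le_max_right _ _).trans hN)) j
  have hQ : ∫⁻ x in T^[j] ⁻¹' A, H x ∂μ < ⊤ := (setLIntegral_le_lintegral _ _).trans_lt hHi
  have hP : ENNReal.ofReal ε * μ (Y ∩ T^[j] ⁻¹' A) < ⊤ :=
    ENNReal.mul_lt_top ENNReal.ofReal_lt_top ((pre_lt_top hT hA hA1 _ _).trans_lt hA1)
  have v1 := ENNReal.toReal_mono (ENNReal.add_lt_top.2 ⟨hQ, hP⟩).ne u1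
  have v2 := ENNReal.toReal_mono (ENNReal.add_lt_top.2 ⟨hE, hP⟩).ne u2
  rw [ENNReal.toReal_add hQ.ne hP.ne, ENNReal.toReal_mul, ENNReal.toReal_ofReal hε.le] at v1
  rw [ENNReal.toReal_add hE.ne hP.ne, ENNReal.toReal_mul, ENNReal.toReal_ofReal hε.le] at v2
  unfold qA pA
  rw [← sub_div, abs_div, abs_of_nonneg (ENNReal.toReal_nonneg (a := μ A)), ← mul_div_assoc]
  gcongr
  rw [abs_le]
  constructor <;> linarith

lemma dyn_tauber (hT : MeasurePreserving T μ μ) (hY : MeasurableSet Y)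
    (hY0 : 0 < μ Y) (hY1 : μ Y < ⊤)
    (hatTmeas : ∀ u, Measurable u → Measurable (hatT u))
    (hatTdual : ∀ u v : X → ℝ≥0∞, Measurable u → Measurable v →
      ∫⁻ x, v (T x) * u x ∂μ = ∫⁻ x, v x * hatT u x ∂μ)
    {α : ℝ} (hα : α ∈ Set.Ioo (0:ℝ) 1)
    (hA3 : ∃ (N : ℕ) (C : ℝ≥0∞) (K : ℕ), C ≠ ⊤ ∧ ∀ n : ℕ, N ≤ n →
      ∀ᵐ x ∂μ.restrict Y,
        1 ≤ C * ∑ j ∈ Finset.range (K + 1), (hatT^[j] (entrance T Y μ hatT n)) x)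
    {H : X → ℝ≥0∞} (hHi : ∫⁻ x, H x ∂μ < ⊤)
    (hA4 : ∀ ε : ℝ≥0∞, 0 < ε → ∀ᶠ n : ℕ in atTop, ∀ᵐ x ∂μ,
      entrance T Y μ hatT n x ≤ H x + ε ∧ H x ≤ entrance T Y μ hatT n x + ε)
    (hr : ∀ t : ℝ, 0 < t → Tendsto (fun n : ℕ => (wrate T Y μ ⌊t * n⌋₊).toReal /
      (wrate T Y μ n).toReal) atTop (𝓝 (t ^ (1 - α))))
    {k m : ℕ → ℕ} (hk : ∀ n, 0 < μ (exc T Y (k n)))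
    (hm1 : ∀ i, 1 ≤ m i) (hm : Tendsto m atTop atTop) :
    Tendsto (fun n => (wrate T Y μ (m n)).toReal / m n *
      ∑ j ∈ Finset.range (m n + 1), qA μ T H (exc T Y (k n)) j) atTop
      (𝓝 (1 / Real.Gamma (2 - α) / Real.Gamma (α + 1))) := by
  obtain ⟨N, C, K, hC, h3⟩ := hA3
  have hme := fun n => meas_exc hT.measurable hY n
  refine renewal_tauber (b := fun k => (μ (exc T Y k)).toReal)
    (w := fun n => (wrate T Y μ n).toReal) (C := C.toReal) (K := K) (N0 := max N 1)
    (p := fun n => pA μ T Y (exc T Y (k n))) (r := fun n => rA μ T Y (exc T Y (k n)))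
    (fun n => ENNReal.toReal_nonneg)
    (fun a c h => ENNReal.toReal_mono (exc_lt_top hY1 _).ne (measure_mono (exc_anti h)))
    ?_ (wrate_toReal hY1) hα.1 hα.2 hr
    (fun n => renewalData_A hT hY hHi (hme _) Set.inter_subset_left (hk n) (exc_lt_top hY1 _))
    ENNReal.toReal_nonneg ?_ ?_ hm1 hm
  · change 0 < (μ (exc T Y 0)).toReal
    rw [exc_zero]; exact ENNReal.toReal_pos hY0.ne' hY1.ne
  · intro M hM i a
    exact sweep_A hT hY hY0 hatTmeas hatTdual hC ((le_max_right _ _).trans hM)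
      (h3 M ((le_max_left _ _).trans hM)) (hme _) (exc_lt_top hY1 _) a
  · intro ε hε
    obtain ⟨N1, h1⟩ := approx_A hT hY hY0 hatTmeas hatTdual hHi hA4 ε hε
    exact ⟨N1, fun M hM i j => h1 M hM _ (hme _) (exc_lt_top hY1 _) j⟩
end fin

lemma gamma_const {α : ℝ} (hα : α ∈ Set.Ioo (0:ℝ) 1) :
    (1 - α) * (1 / Real.Gamma (2 - α) / Real.Gamma (α + 1)) =
      Real.sin (Real.pi * α) / (Real.pi * α) := by
  obtain ⟨h0, h1⟩ := hα
  have e1 : Real.Gamma (2 - α) = (1 - α) * Real.Gamma (1 - α) := by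
    rw [← Real.Gamma_add_one (by linarith)]; congr 1; ring
  have e2 := Real.Gamma_add_one h0.ne'
  have e3 := Real.Gamma_mul_Gamma_one_sub α
  have g1 := Real.Gamma_pos_of_pos h0
  have g2 := Real.Gamma_pos_of_pos (show 0 < 1 - α by linarith)
  have hs : 0 < Real.sin (Real.pi * α) :=
    Real.sin_pos_of_pos_of_lt_pi (by positivity) (by nlinarith [Real.pi_pos])
  have e4 : Real.Gamma α * Real.Gamma (1 - α) * Real.sin (Real.pi * α) = Real.pi := by
    rw [e3]; field_simp
  have h1a : 1 - α ≠ 0 := by linarith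
  rw [e1, e2, div_div, mul_one_div, div_eq_div_iff (by positivity) (by positivity)]
  calc (1 - α) * (Real.pi * α) = (1 - α) * α * (Real.Gamma α * Real.Gamma (1 - α) * Real.sin (Real.pi * α)) := by
        rw [e4]; ring
    _ = _ := by ring

lemma final_analysis {b w : ℕ → ℝ} (h0 : ∀ n, 0 ≤ b n) (hb : Antitone b) (hb0 : 0 < b 0)
    (hw : ∀ n, w n = ∑ k ∈ Finset.range n, b k) {α : ℝ} (hα : α ∈ Set.Ioo (0:ℝ) 1)
    {ℓ : ℝ → ℝ} (hℓmeas : Measurable ℓ) (hℓpos : ∀ t, 0 < t → 0 < ℓ t)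
    (hℓsv : ∀ lam : ℝ, 0 < lam → Tendsto (fun t => ℓ (lam * t) / ℓ t) atTop (𝓝 1))
    (hwl : Tendsto (fun n : ℕ => w n / ((n : ℝ) ^ (1 - α) * ℓ n)) atTop (𝓝 1))
    {c : ℕ → ℝ} (hc : ∀ n, 0 < c n) (hc0 : Tendsto c atTop (𝓝 0))
    (hcn : Tendsto (fun n : ℕ => c n * n) atTop atTop)
    {m : ℕ → ℕ} (hm : ∀ᶠ n in atTop, m n = ⌊c n * n⌋₊)
    {I S1 S2 : ℕ → ℝ} {G : ℝ}
    (hG : (1 - α) * G = Real.sin (Real.pi * α) / (Real.pi * α))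
    (hS1 : Tendsto (fun n => w (m n) / m n * S1 n) atTop (𝓝 G))
    (hS2 : Tendsto (fun n => w (m n) / m n * S2 n) atTop (𝓝 G))
    (hI1 : ∀ᶠ n in atTop, b n * S1 n ≤ I n) (hI2 : ∀ᶠ n in atTop, I n ≤ b (n - m n) * S2 n) :
    Tendsto (fun n : ℕ => I n /
          (Real.sin (Real.pi * α) / (Real.pi * α) * ((c n) ^ α * ℓ n / ℓ (c n * n))))
        atTop (𝓝 1) := by
  have hs : 0 < Real.sin (Real.pi * α) / (Real.pi * α) := by
    obtain ⟨h0, h1⟩ := hα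
    have := Real.sin_pos_of_pos_of_lt_pi (show 0 < Real.pi * α by positivity)
      (by nlinarith [Real.pi_pos])
    positivity
  have hr := fun t ht => w_ratio hℓmeas hℓpos hℓsv hwl t ht
  have hden := mono_density h0 hb hb0 hw hr
  have hmt : Tendsto m atTop atTop :=
    (tendsto_nat_floor_atTop.comp hcn).congr' (hm.mono fun n h => h.symm)
  have hmle : ∀ᶠ n in atTop, (m n : ℝ) ≤ c n * n := by
    filter_upwards [hm] with n h
    rw [h]; exact Nat.floor_le (mul_nonneg (hc n).le (by positivity))
  have hc1 : ∀ᶠ n in atTop, c n < 1/2 := hc0.eventually_lt_const (by norm_num)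
  have hmn : ∀ᶠ n in atTop, m n ≤ n := by
    filter_upwards [hmle, hc1] with n h1 h2
    have : (m n:ℝ) ≤ n := by nlinarith [Nat.cast_nonneg (α := ℝ) n]
    exact_mod_cast this
  -- (n - m)/n → 1
  have hnm : Tendsto (fun n : ℕ => ((n - m n : ℕ) : ℝ) / n) atTop (𝓝 1) := by
    have hl : Tendsto (fun n => 1 - c n) atTop (𝓝 1) := by simpa using hc0.const_sub 1
    refine tendsto_of_tendsto_of_tendsto_of_le_of_le' hl tendsto_const_nhds ?_ ?_
    · filter_upwards [hmle, hmn, eventually_ge_atTop 1] with n h1 h2 h3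
      have hn : (0:ℝ) < n := by exact_mod_cast h3
      rw [le_div_iff₀ hn, Nat.cast_sub h2]; linarith
    · filter_upwards with n
      refine div_le_one_of_le₀ ?_ (by positivity)
      exact_mod_cast Nat.sub_le _ _
  have hk : Tendsto (fun n => n - m n) atTop atTop := by
    have h1 : Tendsto (fun n : ℕ => ((n - m n : ℕ) : ℝ)) atTop atTop := by
      refine (hnm.pos_mul_atTop one_pos (tendsto_natCast_atTop_atTop (R := ℝ))).congr' ?_
      filter_upwards [eventually_ge_atTop 1] with n h3
      have hn : (n:ℝ) ≠ 0 := by positivity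
      field_simp
    exact tendsto_natCast_atTop_iff.1 h1
  have hwp : ∀ n, 1 ≤ n → 0 < w n := fun n h => w_pos h0 hb0 hw h
  have hwr : Tendsto (fun n => w (n - m n) / w n) atTop (𝓝 1) := by
    refine tendsto_of_tendsto_of_tendsto_of_le_of_le' hnm tendsto_const_nhds ?_ ?_
    · filter_upwards [eventually_ge_atTop 1] with n h3
      have hn : (0:ℝ) < n := by exact_mod_cast h3
      rw [div_le_div_iff₀ hn (hwp n h3)]
      linarith [w_conc hb hw (Nat.sub_le n (m n))]
    · filter_upwards [eventually_ge_atTop 1] with n h3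
      exact div_le_one_of_le₀ (w_mono h0 hw (Nat.sub_le _ _)) (hwp n h3).le
  have hden2 : Tendsto (fun n => n * b (n - m n) / w n) atTop (𝓝 (1 - α)) := by
    have := ((hden.comp hk).mul hwr).div hnm one_ne_zero
    simp only [mul_one, div_one] at this
    refine this.congr' ?_
    filter_upwards [eventually_ge_atTop 1, hk.eventually_ge_atTop 1] with n h1 h2
    have a1 : (n:ℝ) ≠ 0 := by positivity
    have a2 : ((n - m n : ℕ):ℝ) ≠ 0 := by positivity
    have a3 := (hwp n h1).ne'
    have a4 := (hwp _ h2).ne'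
    simp only [Function.comp, Pi.mul_apply, Pi.div_apply]
    field_simp
  -- normalisation
  set R : ℕ → ℝ := fun n => n * w (m n) / (w n * m n) with hR
  have hIR : Tendsto (fun n => R n * I n) atTop (𝓝 ((1 - α) * G)) := by
    refine tendsto_of_tendsto_of_tendsto_of_le_of_le' (hden.mul hS1) (hden2.mul hS2) ?_ ?_
    · filter_upwards [hI1, eventually_ge_atTop 1, hmt.eventually_ge_atTop 1] with n h1 h2 h3
      have a1 := hwp n h2
      have a2 := hwp _ h3
      have a3 : (0:ℝ) < m n := by exact_mod_cast h3
      calc (n:ℝ) * b n / w n * (w (m n) / m n * S1 n) = R n * (b n * S1 n) := by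
            simp only [hR]; field_simp
        _ ≤ R n * I n := mul_le_mul_of_nonneg_left h1 (by simp only [hR]; positivity)
    · filter_upwards [hI2, eventually_ge_atTop 1, hmt.eventually_ge_atTop 1] with n h1 h2 h3
      have a1 := hwp n h2
      have a2 := hwp _ h3
      have a3 : (0:ℝ) < m n := by exact_mod_cast h3
      calc R n * I n ≤ R n * (b (n - m n) * S2 n) :=
            mul_le_mul_of_nonneg_left h1 (by simp only [hR]; positivity)
        _ = (n:ℝ) * b (n - m n) / w n * (w (m n) / m n * S2 n) := by
            simp only [hR]; field_simp
  have hRD : Tendsto (fun n => R n * ((c n) ^ α * ℓ n / ℓ (c n * n))) atTop (𝓝 1) := by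
    have h1 := (w_floor hℓmeas hℓpos hℓsv hwl).comp hcn
    have h2 := floor_div_tendsto.comp hcn
    have h3 := (h1.div hwl one_ne_zero).div h2 one_ne_zero
    simp only [div_one] at h3
    refine h3.congr' ?_
    filter_upwards [hm, eventually_ge_atTop 1, hmt.eventually_ge_atTop 1] with n e h2 h3
    have hn : (0:ℝ) < n := by exact_mod_cast h2
    have a1 := hwp n h2
    have a2 := hwp _ h3
    have a3 : (0:ℝ) < m n := by exact_mod_cast h3
    have hcp := hc n
    have l1 := hℓpos n hn
    have l2 := hℓpos (c n * n) (by positivity)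
    simp only [Function.comp, Pi.div_apply, hR, ← e]
    have x1 : (c n * n) ^ (1 - α) = (c n * n) / ((c n) ^ α * (n:ℝ) ^ α) := by
      rw [Real.rpow_sub (by positivity), Real.rpow_one, Real.mul_rpow hcp.le hn.le]
    have x2 : (n:ℝ) ^ (1 - α) = n / (n:ℝ) ^ α := by
      rw [Real.rpow_sub hn, Real.rpow_one]
    rw [x1, x2]
    have p1 := Real.rpow_pos_of_pos hcp α
    have p2 := Real.rpow_pos_of_pos hn α
    field_simp
  have hfin := (hIR.div (hRD.const_mul (Real.sin (Real.pi * α) / (Real.pi * α)))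
    (by simpa using hs.ne'))
  rw [hG, mul_one, div_self hs.ne'] at hfin
  refine hfin.congr' ?_
  filter_upwards [eventually_ge_atTop 1, hmt.eventually_ge_atTop 1] with n h2 h3
  have hn : (0:ℝ) < n := by exact_mod_cast h2
  have a1 := hwp n h2
  have a2 := hwp _ h3
  have a3 : (0:ℝ) < m n := by exact_mod_cast h3
  have hRp : R n ≠ 0 := by simp only [hR]; positivity
  simp only [Pi.div_apply]
  rw [mul_left_comm, mul_div_mul_left _ _ hRp]

/-- Large deviation estimate related to the Dynkin–Lamperti arcsine law:
`μ_H(Z_n^Y/n ≤ c(n)) ~ (sin πα)/(πα) · c(n)^α ℓ(n)/ℓ(c(n)n)`. -/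
theorem stmt15 {X : Type*} [MeasurableSpace X] {μ : Measure X} [SigmaFinite μ]
    {T : X → X} (hcons : Conservative T μ) (herg : Ergodic T μ)
    (hinf : μ Set.univ = ⊤) {Y : Set X} (hYm : MeasurableSet Y)
    (hY0 : 0 < μ Y) (hY1 : μ Y < ⊤)
    (hatT : (X → ℝ≥0∞) → (X → ℝ≥0∞))
    (hatTmeas : ∀ u, Measurable u → Measurable (hatT u))
    (hatTdual : ∀ u v : X → ℝ≥0∞, Measurable u → Measurable v →
      ∫⁻ x, v (T x) * u x ∂μ = ∫⁻ x, v x * hatT u x ∂μ)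
    (α : ℝ) (hα : α ∈ Set.Ioo (0:ℝ) 1)
    (ℓ : ℝ → ℝ) (hℓmeas : Measurable ℓ) (hℓpos : ∀ t, 0 < t → 0 < ℓ t)
    (hℓsv : ∀ lam : ℝ, 0 < lam → Tendsto (fun t => ℓ (lam * t) / ℓ t) atTop (𝓝 1))
    -- (A2): `w_n^Y ~ n^{1-α} ℓ(n)`
    (hw : Tendsto (fun n : ℕ => (wrate T Y μ n).toReal / ((n : ℝ) ^ (1 - α) * ℓ n))
      atTop (𝓝 1))
    -- (A3): uniform sweeping of the entrance densities for `1_Y`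
    (hA3 : ∃ (N : ℕ) (C : ℝ≥0∞) (K : ℕ), C ≠ ⊤ ∧ ∀ n : ℕ, N ≤ n →
      ∀ᵐ x ∂μ.restrict Y,
        1 ≤ C * ∑ j ∈ Finset.range (K + 1), (hatT^[j] (entrance T Y μ hatT n)) x)
    -- (A4): `L^∞` convergence of the entrance densities to `H`
    (H : X → ℝ≥0∞) (hHmeas : Measurable H)
    (hHbd : ∃ M : ℝ≥0∞, M ≠ ⊤ ∧ ∀ᵐ x ∂μ, H x ≤ M)
    (hA4 : ∀ ε : ℝ≥0∞, 0 < ε → ∀ᶠ n : ℕ in atTop, ∀ᵐ x ∂μ,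
      entrance T Y μ hatT n x ≤ H x + ε ∧ H x ≤ entrance T Y μ hatT n x + ε) :
    ∀ c : ℕ → ℝ, (∀ n, 0 < c n) → Tendsto c atTop (𝓝 0) →
      Tendsto (fun n : ℕ => c n * n) atTop atTop →
      Tendsto (fun n : ℕ =>
        (∫⁻ x in {x | (lastVisit T Y n x : ℝ) ≤ c n * n}, H x ∂μ).toReal /
          (Real.sin (Real.pi * α) / (Real.pi * α) * ((c n) ^ α * ℓ n / ℓ (c n * n))))
        atTop (𝓝 1) := by
  intro c hc hc0 hcn
  have hT : MeasurePreserving T μ μ := herg.toMeasurePreserving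
  have hTm := hT.measurable
  have hHoff := H_off hTm hYm hatTmeas hatTdual hA4
  have hHi := H_int_lt_top hY1 hYm hHbd hHoff
  set b : ℕ → ℝ := fun k => (μ (exc T Y k)).toReal with hbdef
  set w : ℕ → ℝ := fun n => (wrate T Y μ n).toReal with hwdef
  have h0 : ∀ n, 0 ≤ b n := fun n => ENNReal.toReal_nonneg
  have hb : Antitone b := fun a c h =>
    ENNReal.toReal_mono (exc_lt_top hY1 _).ne (measure_mono (exc_anti h))
  have hb0 : 0 < b 0 := by
    change 0 < (μ (exc T Y 0)).toReal
    rw [exc_zero]; exact ENNReal.toReal_pos hY0.ne' hY1.ne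
  have hwb : ∀ n, w n = ∑ k ∈ Finset.range n, b k := wrate_toReal hY1
  have hr : ∀ t : ℝ, 0 < t → Tendsto (fun n : ℕ => w ⌊t * n⌋₊ / w n) atTop (𝓝 (t ^ (1 - α))) :=
    fun t ht => w_ratio hℓmeas hℓpos hℓsv hw t ht
  have hbpos : ∀ n, 0 < b n := by
    intro n
    have h1 : ∀ᶠ k : ℕ in atTop, 0 < k * b k / w k :=
      (mono_density h0 hb hb0 hwb hr).eventually_const_lt (by linarith [hα.2])
    obtain ⟨k, h1, h2⟩ := (h1.and (eventually_ge_atTop n)).exists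
    refine lt_of_lt_of_le ?_ (hb h2)
    refine lt_of_le_of_ne (h0 k) fun h => ?_
    rw [← h] at h1
    simp at h1
  have hepos : ∀ n, 0 < μ (exc T Y n) := fun n => (ENNReal.toReal_pos_iff.1 (hbpos n)).1
  set m : ℕ → ℕ := fun n => max 1 ⌊c n * n⌋₊ with hmdef
  have hm1 : ∀ n, 1 ≤ m n := fun n => le_max_left _ _
  have hfl := tendsto_nat_floor_atTop.comp hcn
  have hm : ∀ᶠ n in atTop, m n = ⌊c n * n⌋₊ := by
    filter_upwards [hfl.eventually_ge_atTop 1] with n h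
    exact max_eq_right h
  have hmt : Tendsto m atTop atTop := hfl.congr' (hm.mono fun n h => h.symm)
  have hmn : ∀ᶠ n in atTop, m n ≤ n := by
    filter_upwards [hm, hc0.eventually_lt_const one_pos] with n h1 h2
    rw [h1]
    refine Nat.floor_le_of_le ?_
    nlinarith [Nat.cast_nonneg (α := ℝ) n]
  have hdt := fun k hk => dyn_tauber (k := k) hT hYm hY0 hY1 hatTmeas hatTdual hα hA3 hHi hA4 hr hk hm1 hmt
  have hI : ∀ᶠ n in atTop, (∫⁻ x in {x | (lastVisit T Y n x : ℝ) ≤ c n * n}, H x ∂μ).toReal =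
      ∑ j ∈ Finset.range (m n + 1), (∫⁻ x in T^[j] ⁻¹' exc T Y (n - j), H x ∂μ).toReal := by
    filter_upwards [hm, hmn] with n h1 h2
    have e : {x | (lastVisit T Y n x : ℝ) ≤ c n * n} = {x | lastVisit T Y n x ≤ m n} := by
      ext x
      change (lastVisit T Y n x : ℝ) ≤ c n * n ↔ lastVisit T Y n x ≤ m n
      rw [h1, Nat.le_floor_iff (mul_nonneg (hc n).le (by positivity))]
    rw [e, lastVisit_int hTm hYm hHoff h2, ENNReal.toReal_sum]
    exact fun j _ => ((setLIntegral_le_lintegral _ _).trans_lt hHi).ne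
  have hmono : ∀ {A B : Set X}, A ⊆ B → ∀ j : ℕ,
      (∫⁻ x in T^[j] ⁻¹' A, H x ∂μ).toReal ≤ (∫⁻ x in T^[j] ⁻¹' B, H x ∂μ).toReal :=
    fun h j => ENNReal.toReal_mono ((setLIntegral_le_lintegral _ _).trans_lt hHi).ne
      (lintegral_mono_set (Set.preimage_mono h))
  have hbq : ∀ k j, b k * qA μ T H (exc T Y k) j = (∫⁻ x in T^[j] ⁻¹' exc T Y k, H x ∂μ).toReal :=
    fun k j => mul_div_cancel₀ _ (hbpos k).ne'
  refine final_analysis h0 hb hb0 hwb hα hℓmeas hℓpos hℓsv hw hc hc0 hcn hm (gamma_const hα)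
    (hdt (fun n => n) (fun n => hepos n)) (hdt (fun n => n - m n) (fun n => hepos _)) ?_ ?_
  · filter_upwards [hI] with n h
    rw [h, Finset.mul_sum]
    refine Finset.sum_le_sum fun j _ => ?_
    rw [hbq]
    exact hmono (exc_anti (Nat.sub_le _ _)) j
  · filter_upwards [hI] with n h
    rw [h, Finset.mul_sum]
    refine Finset.sum_le_sum fun j hj => ?_
    rw [hbq]
    have : j < m n + 1 := Finset.mem_range.1 hj
    exact hmono (exc_anti (by omega)) j
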